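/- Let τ, η, p ∈ ℂ and Λ₁,…,Λₙ ∈ ℂ. For each weight Λ ∈ {Λ₁,…,Λₙ} let V_Λ be a finite-dimensional ℂ-vector space with a weight decomposition and weight operator h, and for each ordered pair (Λ,M) let R_{Λ,M}(z,λ) ∈ End(V_Λ⊗V_M) be operators commuting with h^{(1)}+h^{(2)} (zero weight) and satisfying the dynamical Yang–Baxter equation: R_{Λ₁',Λ₂'}(z,λ−2ηh^{(3)})^{(12)} R_{Λ₁',Λ₃'}(z+w,λ)^{(13)} R_{Λ₂',Λ₃'}(w,λ−2ηh^{(1)})^{(23)} = R_{Λ₂',Λ₃'}(w,λ)^{(23)} R_{Λ₁',Λ₃'}(z+w,λ−2ηh^{(2)})^{(13)} R_{Λ₁',Λ₂'}(z,λ)^{(12)} on V_{Λ₁'}⊗V_{Λ₂'}⊗V_{Λ₃'} for all Λ₁',Λ₂',Λ₃' ∈ {Λ₁,…,Λₙ} and all z,w,λ. Let K_j^{Λ₁,…,Λₙ}(z₁,…,zₙ,λ) denote the qKZB operators with step p built from these R-matrices, acting on functions of λ with values in the zero-weight space (V_{Λ₁}⊗…⊗V_{Λₙ})[0]. Suppose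 Ψ(z₁,…,zₙ,λ) with values in (V_{Λ₁}⊗…⊗V_{Λₙ})[0] solves Ψ(z₁,…,z_i+p,…,zₙ) = K_i^{Λ₁,…,Λₙ}(z)Ψ(z) for all i. Then for each j = 1,…,n−1 the function Ψ_j(z₁,…,zₙ,λ) = P^{(j,j+1)} R^{(j,j+1)}_{Λ_j,Λ_{j+1}}(z_{j+1}−z_j, λ−2η∑_{l=1}^{j−1}h^{(l)}) Ψ(z₁,…,z_{j+1},z_j,…,zₙ,λ), with values in (V_{Λ₁}⊗…⊗V_{Λ_{j+1}}⊗V_{Λ_j}⊗…⊗V_{Λₙ})[0], solves the qKZB equations with the weights Λ_j and Λ_{j+1} (and the corresponding factors) interchanged: Ψ_j(z₁,…,z_i+p,…,zₙ) = K_i^{…,Λ_{j+1},Λ_j,…}(z)Ψ_j(z) for all i. Here P^{(j,j+1)} permutes the j-th and (j+1)-th tensor factors. -/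

import Mathlib

open Complex Finset

/-- `α(λ) = exp(−πiλ²/(4η))`. -/
noncomputable def alphaFn (η lam : ℂ) : ℂ :=
  Complex.exp (-(Real.pi * I * lam ^ 2) / (4 * η))

/-- The operator `R_{k,l}(w)` of multiplication by
`R_{Λ_k,Λ_l}(w, λ − 2η∑_{i<l, i≠k} h^{(i)})^{(k,l)}`, acting on functions of `λ`
with values in the tensor product (modelled as functions on the product of the
bases `B i`, with weights `wt i`). -/
noncomputable def Rop {n : ℕ} (B : Fin n → Type*) [∀ i, Fintype (B i)]
    [∀ i, DecidableEq (B i)] (wt : ∀ i, B i → ℂ) (η : ℂ)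
    (R : ∀ k l : Fin n, ℂ → ℂ → (B k × B l) → (B k × B l) → ℂ)
    (k l : Fin n) (w : ℂ) (Ψ : ℂ → (∀ i, B i) → ℂ) : ℂ → (∀ i, B i) → ℂ :=
  fun lam b => ∑ c : B k × B l,
    R k l w (lam - 2 * η * ∑ i ∈ Finset.univ.filter (fun i : Fin n => i < l ∧ i ≠ k),
        wt i (b i)) (b k, b l) c *
      Ψ lam (Function.update (Function.update b k c.1) l c.2)

/-- The shift operator `Γ_j`: `(Γ_jΨ)(λ) = Ψ(λ−2ημ)` on components of
`h^{(j)}`-weight `μ`. -/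
noncomputable def Gammaop {n : ℕ} (B : Fin n → Type*) (wt : ∀ i, B i → ℂ)
    (η : ℂ) (j : Fin n) (Ψ : ℂ → (∀ i, B i) → ℂ) : ℂ → (∀ i, B i) → ℂ :=
  fun lam b => Ψ (lam - 2 * η * wt j (b j)) b

/-- The qKZB operator
`K_j(z,λ) = R_{j,j−1}(z_j−z_{j−1}+p)⋯R_{j,1}(z_j−z_1+p) Γ_j
R_{j,n}(z_j−z_n)⋯R_{j,j+1}(z_j−z_{j+1})`. -/
noncomputable def Kop {n : ℕ} (B : Fin n → Type*) [∀ i, Fintype (B i)]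
    [∀ i, DecidableEq (B i)] (wt : ∀ i, B i → ℂ) (η p : ℂ)
    (R : ∀ k l : Fin n, ℂ → ℂ → (B k × B l) → (B k × B l) → ℂ)
    (j : Fin n) (z : Fin n → ℂ) :
    (ℂ → (∀ i, B i) → ℂ) → (ℂ → (∀ i, B i) → ℂ) :=
  ((((List.finRange n).filter (fun l => l < j)).reverse.map
      (fun l => Rop B wt η R j l (z j - z l + p))).foldr (· ∘ ·) id) ∘
    Gammaop B wt η j ∘
    ((((List.finRange n).filter (fun l => j < l)).reverse.map
      (fun l => Rop B wt η R j l (z j - z l))).foldr (· ∘ ·) id)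


/-- `R^{(12)}` on the triple tensor product `V_k ⊗ V_l ⊗ V_{m'}`, with the
dynamical parameter a function of the spectator (third) index. -/
noncomputable def T12 {n : ℕ} (B : Fin n → Type*)
    (R : ∀ k l : Fin n, ℂ → ℂ → (B k × B l) → (B k × B l) → ℂ)
    (k l m' : Fin n) (u : ℂ) (lamf : B m' → ℂ) [DecidableEq (B m')]
    (b c : B k × B l × B m') : ℂ :=
  if b.2.2 = c.2.2 then R k l u (lamf c.2.2) (b.1, b.2.1) (c.1, c.2.1) else 0

/-- `R^{(13)}` on the triple tensor product, dynamical parameter a function of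
the spectator (second) index. -/
noncomputable def T13 {n : ℕ} (B : Fin n → Type*)
    (R : ∀ k l : Fin n, ℂ → ℂ → (B k × B l) → (B k × B l) → ℂ)
    (k l m' : Fin n) (u : ℂ) (lamf : B l → ℂ) [DecidableEq (B l)]
    (b c : B k × B l × B m') : ℂ :=
  if b.2.1 = c.2.1 then R k m' u (lamf c.2.1) (b.1, b.2.2) (c.1, c.2.2) else 0

/-- `R^{(23)}` on the triple tensor product, dynamical parameter a function of
the spectator (first) index. -/
noncomputable def T23 {n : ℕ} (B : Fin n → Type*)
    (R : ∀ k l : Fin n, ℂ → ℂ → (B k × B l) → (B k × B l) → ℂ)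
    (k l m' : Fin n) (u : ℂ) (lamf : B k → ℂ) [DecidableEq (B k)]
    (b c : B k × B l × B m') : ℂ :=
  if b.1 = c.1 then R l m' u (lamf c.1) (b.2.1, b.2.2) (c.2.1, c.2.2) else 0

/-- Reindexing of a basis vector of the permuted tensor product: from
`b' : ∀ i, B (σ i)` produce an element of `∀ i, B i`. -/
def permBasis {n : ℕ} {B : Fin n → Type*} (σ : Equiv.Perm (Fin n))
    (b' : ∀ i, B (σ i)) : ∀ i, B i :=
  fun i => (congrArg B (σ.apply_symm_apply i)) ▸ b' (σ.symm i)

set_option linter.unusedSectionVars false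
set_option linter.unusedVariables false

/-! ### Abstract part: the algebra of the operators -/

/-- The relations among the R-operators and shift operators. -/
structure QSys (n : ℕ) (A : Type*) [Ring A] where
  r : Fin n → Fin n → Finset (Fin n) → ℂ → A
  g : Fin n → A
  yb : ∀ (k l m : Fin n) (S : Finset (Fin n)) (u v : ℂ), k ≠ l → k ≠ m → l ≠ m →
    k ∉ S → l ∉ S → m ∉ S →
    r k l (insert m S) u * r k m S (u + v) * r l m (insert k S) v =
      r l m S v * r k m (insert l S) (u + v) * r k l S u
  comm : ∀ (a b c d : Fin n) (S S' : Finset (Fin n)) (u v : ℂ), a ≠ b → c ≠ d →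
    a ≠ c → a ≠ d → b ≠ c → b ≠ d → (a ∈ S' ↔ b ∈ S') → (c ∈ S ↔ d ∈ S) →
    r a b S u * r c d S' v = r c d S' v * r a b S u
  gr : ∀ (a k l : Fin n) (S : Finset (Fin n)) (u : ℂ), a ≠ k → a ≠ l → k ≠ l → a ∉ S →
    g a * r k l S u = r k l (insert a S) u * g a
  gg : ∀ a b, g a * g b = g b * g a
  ggr : ∀ (k l : Fin n) (S : Finset (Fin n)) (u : ℂ), k ≠ l → k ∉ S → l ∉ S →
    g k * g l * r k l S u = r k l (insert k (insert l S)) u * (g k * g l)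
  runiv : ∀ (k l : Fin n) (u : ℂ), r k l Finset.univ u = r k l ∅ u

namespace QSys

variable {n : ℕ} {A : Type*} [Ring A] (Q : QSys n A)

/-- Ordered product of R-operators of the space `a` with the spaces of a list. -/
def P (a : Fin n) (v : ℂ) (w : Fin n → ℂ) : List (Fin n) → Finset (Fin n) → A
  | [], _ => 1
  | l :: t, S => P a v w t (insert l S) * Q.r a l S (v - w l)

theorem P_append (a : Fin n) (v : ℂ) (w : Fin n → ℂ) (x y : List (Fin n)) (S : Finset (Fin n)) :
    Q.P a v w (x ++ y) S = Q.P a v w y (S ∪ x.toFinset) * Q.P a v w x S := by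
  induction x generalizing S with
  | nil => simp [P]
  | cons l t ih =>
    simp only [List.cons_append, P, ih, mul_assoc]
    have e : insert l S ∪ t.toFinset = S ∪ (l :: t).toFinset := by
      ext; simp only [Finset.mem_union, Finset.mem_insert, List.mem_toFinset, List.mem_cons]; tauto
    rw [e]

theorem P_congr (a : Fin n) (v : ℂ) (w w' : Fin n → ℂ) (x : List (Fin n)) (S : Finset (Fin n))
    (h : ∀ l ∈ x, w l = w' l) : Q.P a v w x S = Q.P a v w' x S := by
  induction x generalizing S with
  | nil => rfl
  | cons l t ih =>
    simp only [P]
    rw [ih _ (fun m hm => h m (by simp [hm])), h l (by simp)]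

theorem P_comm (a c d : Fin n) (v : ℂ) (w : Fin n → ℂ) (u : ℂ) (t : List (Fin n))
    (S S' : Finset (Fin n)) (hac : a ≠ c) (had : a ≠ d) (hcd : c ≠ d) (hat : a ∉ t)
    (hct : c ∉ t) (hdt : d ∉ t) (h1 : ∀ m ∈ t, (a ∈ S' ↔ m ∈ S')) (h2 : c ∈ S ↔ d ∈ S) :
    Q.P a v w t S * Q.r c d S' u = Q.r c d S' u * Q.P a v w t S := by
  induction t generalizing S with
  | nil => simp [P]
  | cons l t ih =>
    simp only [List.mem_cons, not_or] at hat hct hdt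
    simp only [P]
    rw [mul_assoc, Q.comm a l c d _ _ _ _ hat.1 hcd hac had (Ne.symm hct.1) (Ne.symm hdt.1)
      (h1 l (by simp)) h2, ← mul_assoc, ih _ hat.2 hct.2 hdt.2
      (fun m hm => h1 m (by simp [hm])), mul_assoc]
    simp [hct.1, hdt.1, h2]

theorem PP_comm (a b : Fin n) (v v' : ℂ) (w : Fin n → ℂ) (t t' : List (Fin n))
    (S S' : Finset (Fin n)) (hab : a ≠ b) (hat : a ∉ t) (hbt : b ∉ t) (hat' : a ∉ t')
    (hbt' : b ∉ t') (hd : ∀ m ∈ t, m ∉ t') (haS : a ∉ S') (hS : ∀ m ∈ t, m ∉ S')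
    (hbS : b ∈ S) (hS' : ∀ m ∈ t', m ∈ S) :
    Q.P a v w t S * Q.P b v' w t' S' = Q.P b v' w t' S' * Q.P a v w t S := by
  induction t' generalizing S' with
  | nil => simp [P]
  | cons l t' ih =>
    simp only [List.mem_cons, not_or] at hat' hbt' hd hS'
    simp only [P]
    rw [← mul_assoc, ih (insert l S') hat'.2 hbt'.2 (fun m hm => (hd m hm).2)
      (by simp [haS, hat'.1]) (fun m hm => by simp [hS m hm, (hd m hm).1])
      (fun m hm => hS' m (Or.inr hm)), mul_assoc, mul_assoc]
    congr 1
    apply Q.P_comm a b l v w _ t S S' hab hat'.1 hbt'.1 hat hbt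
    · intro h; exact (hd l h).1 rfl
    · intro m hm; simp [haS, hS m hm]
    · simp [hbS, hS' l (Or.inl rfl)]

theorem g_P (a b : Fin n) (v : ℂ) (w : Fin n → ℂ) (t : List (Fin n)) (S : Finset (Fin n))
    (hab : b ≠ a) (hat : a ∉ t) (hbt : b ∉ t) (hbS : b ∉ S) :
    Q.g b * Q.P a v w t S = Q.P a v w t (insert b S) * Q.g b := by
  induction t generalizing S with
  | nil => simp [P]
  | cons l t ih =>
    simp only [List.mem_cons, not_or] at hat hbt
    simp only [P]
    rw [← mul_assoc, ih _ hat.2 hbt.2 (by simp [hbt.1, hbS]), mul_assoc,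
      Q.gr b a l S _ hab hbt.1 hat.1 hbS, ← mul_assoc, Finset.insert_comm]

/-- Moving `r a b` through a double product. -/
theorem yb_list (a b : Fin n) (va vb : ℂ) (w : Fin n → ℂ) (t : List (Fin n)) (u : ℂ)
    (hu : u = va - vb)
    (S : Finset (Fin n)) (hab : a ≠ b) (ht : t.Nodup) (hat : a ∉ t) (hbt : b ∉ t)
    (haS : a ∉ S) (hbS : b ∉ S) (hS : ∀ m ∈ t, m ∉ S) :
    Q.P b vb w t S * Q.P a va w t (insert b S) * Q.r a b S u =
      Q.r a b (S ∪ t.toFinset) u * (Q.P a va w t S * Q.P b vb w t (insert a S)) := by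
  induction t generalizing S with
  | nil => simp [P]
  | cons l t ih =>
    simp only [List.mem_cons, not_or] at hat hbt
    have hlt : l ∉ t := (List.nodup_cons.1 ht).1
    have hlS : l ∉ S := hS l (by simp)
    have hmS : ∀ m ∈ t, m ∉ S := fun m hm => hS m (by simp [hm])
    simp only [P]
    have e1 : Q.r b l S (vb - w l) * Q.P a va w t (insert l (insert b S)) =
        Q.P a va w t (insert l (insert b S)) * Q.r b l S (vb - w l) := by
      refine (Q.P_comm a b l va w _ t _ S hab hat.1 hbt.1 hat.2 hbt.2 hlt ?_ ?_).symm
      · intro m hm; simp [haS, hmS m hm]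
      · simp
    have e2 : Q.r a l S (va - w l) * Q.P b vb w t (insert l (insert a S)) =
        Q.P b vb w t (insert l (insert a S)) * Q.r a l S (va - w l) := by
      refine (Q.P_comm b a l vb w _ t _ S hab.symm hbt.1 hat.1 hbt.2 hat.2 hlt ?_ ?_).symm
      · intro m hm; simp [hbS, hmS m hm]
      · simp
    have e3 := Q.yb a b l S u (vb - w l) hab hat.1 hbt.1 haS hbS hlS
    have e4 : u + (vb - w l) = va - w l := by rw [hu]; ring
    rw [e4] at e3
    have ih' := ih (insert l S) (List.nodup_cons.1 ht).2 hat.2 hbt.2 (by simp [haS, hat.1])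
      (by simp [hbS, hbt.1]) (fun m hm => by
        simp only [Finset.mem_insert, not_or]
        exact ⟨fun h => hlt (h ▸ hm), hmS m hm⟩)
    have e5 : S ∪ (l :: t).toFinset = insert l S ∪ t.toFinset := by
      ext; simp only [Finset.mem_union, Finset.mem_insert, List.mem_toFinset, List.mem_cons]; tauto
    rw [e5]
    rw [Finset.insert_comm l b] at e1
    rw [Finset.insert_comm l a] at e2
    rw [Finset.insert_comm l b, Finset.insert_comm l a]
    calc _ = Q.P b vb w t (insert l S) * (Q.r b l S (vb - w l) *
          Q.P a va w t (insert b (insert l S))) * Q.r a l (insert b S) (va - w l) *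
            Q.r a b S u := by simp only [mul_assoc]
      _ = Q.P b vb w t (insert l S) * Q.P a va w t (insert b (insert l S)) *
          (Q.r b l S (vb - w l) * Q.r a l (insert b S) (va - w l) * Q.r a b S u) := by
          rw [e1]; simp only [mul_assoc]
      _ = (Q.P b vb w t (insert l S) * Q.P a va w t (insert b (insert l S)) *
          Q.r a b (insert l S) u) * (Q.r a l S (va - w l) *
            Q.r b l (insert a S) (vb - w l)) := by
          rw [← e3]; simp only [mul_assoc]
      _ = Q.r a b (insert l S ∪ t.toFinset) u * (Q.P a va w t (insert l S) *
          (Q.P b vb w t (insert a (insert l S)) * Q.r a l S (va - w l)) *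
            Q.r b l (insert a S) (vb - w l)) := by
          rw [ih']; simp only [mul_assoc]
      _ = _ := by rw [← e2]; simp only [mul_assoc]

/-- The qKZB operator of space `i`, in a product ordered as `lo ++ i :: hi`. -/
def K (p : ℂ) (w : Fin n → ℂ) (lo : List (Fin n)) (i : Fin n) (hi : List (Fin n)) : A :=
  Q.P i (w i + p) w lo ∅ * Q.g i * Q.P i (w i) w hi lo.toFinset

/-- `K` without the factor between `a` and its neighbour `b`. -/
def X (p : ℂ) (w : Fin n → ℂ) (lo hi : List (Fin n)) (a b : Fin n) (v : ℂ) : A :=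
  Q.P a (v + p) w lo ∅ * Q.g a * Q.P a v w hi (insert b lo.toFinset)

theorem X_mul (p : ℂ) (w : Fin n → ℂ) (lo hi : List (Fin n)) (a b : Fin n) (va vb : ℂ)
    (hn : (a :: b :: (lo ++ hi)).Nodup) :
    Q.X p w lo hi b a vb * Q.X p w lo hi a b va =
      (Q.P b (vb + p) w lo ∅ * Q.P a (va + p) w lo (insert b ∅)) * (Q.g a * Q.g b) *
        (Q.P b vb w hi lo.toFinset * Q.P a va w hi (insert b lo.toFinset)) := by
  simp only [List.nodup_cons, List.mem_cons, List.mem_append, not_or, List.nodup_append] at hn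
  obtain ⟨⟨hab, halo, hahi⟩, ⟨hblo, hbhi⟩, hlo, hhi, hd⟩ := hn
  have e1 : Q.P b vb w hi (insert a lo.toFinset) * Q.P a (va + p) w lo ∅ =
      Q.P a (va + p) w lo ∅ * Q.P b vb w hi (insert a lo.toFinset) := by
    apply Q.PP_comm b a _ _ w hi lo _ _ (Ne.symm hab) hbhi hahi hblo halo
    · intro m hm hm'; exact hd m hm' m hm rfl
    · simp
    · simp
    · simp
    · intro m hm; simp [hm]
  have e2 : Q.g a * Q.P b vb w hi lo.toFinset = Q.P b vb w hi (insert a lo.toFinset) * Q.g a :=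
    Q.g_P b a vb w hi _ hab hbhi hahi (by simp [halo])
  have e3 : Q.g b * Q.P a (va + p) w lo ∅ = Q.P a (va + p) w lo (insert b ∅) * Q.g b :=
    Q.g_P a b _ w lo _ (Ne.symm hab) halo hblo (by simp)
  simp only [X]
  calc _ = Q.P b (vb + p) w lo ∅ * Q.g b * (Q.P b vb w hi (insert a lo.toFinset) *
        Q.P a (va + p) w lo ∅) * Q.g a * Q.P a va w hi (insert b lo.toFinset) := by
        simp only [mul_assoc]
    _ = Q.P b (vb + p) w lo ∅ * (Q.g b * Q.P a (va + p) w lo ∅) *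
        (Q.P b vb w hi (insert a lo.toFinset) * Q.g a) *
          Q.P a va w hi (insert b lo.toFinset) := by
        rw [e1]; simp only [mul_assoc]
    _ = Q.P b (vb + p) w lo ∅ * Q.P a (va + p) w lo (insert b ∅) * (Q.g b *
        Q.g a) * (Q.P b vb w hi lo.toFinset * Q.P a va w hi (insert b lo.toFinset)) := by
        rw [e3, ← e2]; simp only [mul_assoc]
    _ = _ := by rw [Q.gg b a]

theorem XX (p : ℂ) (w : Fin n → ℂ) (lo hi : List (Fin n)) (a b : Fin n) (va vb : ℂ)
    (hn : (a :: b :: (lo ++ hi)).Nodup) (hall : ∀ i, i ∈ a :: b :: (lo ++ hi)) (u : ℂ)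
    (hu : u = va - vb) :
    Q.X p w lo hi b a vb * Q.X p w lo hi a b va * Q.r a b lo.toFinset u =
      Q.r a b lo.toFinset u * (Q.X p w lo hi a b va * Q.X p w lo hi b a vb) := by
  have hn' : (b :: a :: (lo ++ hi)).Nodup := (List.Perm.swap _ _ _).nodup_iff.1 hn
  rw [Q.X_mul p w lo hi a b va vb hn, Q.X_mul p w lo hi b a vb va hn']
  simp only [List.nodup_cons, List.mem_cons, List.mem_append, not_or, List.nodup_append] at hn
  obtain ⟨⟨hab, halo, hahi⟩, ⟨hblo, hbhi⟩, hlo, hhi, hd⟩ := hn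
  have y1 := Q.yb_list a b va vb w hi u hu lo.toFinset hab hhi hahi hbhi (by simp [halo])
    (by simp [hblo]) (fun m hm => by
      simp only [List.mem_toFinset]; exact fun h => hd m h m hm rfl)
  have y2 := Q.yb_list a b (va + p) (vb + p) w lo u (by rw [hu]; ring) ∅ hab hlo halo hblo
    (by simp) (by simp) (by simp)
  have y3 := Q.ggr a b (lo.toFinset ∪ hi.toFinset) u hab (by simp [halo, hahi])
    (by simp [hblo, hbhi])
  have e : insert a (insert b (lo.toFinset ∪ hi.toFinset)) = Finset.univ := by
    ext i; have := hall i; simpa using this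
  rw [e, Q.runiv] at y3
  rw [Finset.empty_union] at y2
  calc _ = (Q.P b (vb + p) w lo ∅ * Q.P a (va + p) w lo (insert b ∅)) *
        ((Q.g a * Q.g b) * Q.r a b (lo.toFinset ∪ hi.toFinset) u) *
          (Q.P a va w hi lo.toFinset * Q.P b vb w hi (insert a lo.toFinset)) := by
        rw [mul_assoc, y1]; simp only [mul_assoc]
    _ = (Q.P b (vb + p) w lo ∅ * Q.P a (va + p) w lo (insert b ∅) * Q.r a b ∅ u) *
        (Q.g a * Q.g b) *
          (Q.P a va w hi lo.toFinset * Q.P b vb w hi (insert a lo.toFinset)) := by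
        rw [y3]; simp only [mul_assoc]
    _ = _ := by rw [y2, Q.gg b a]; simp only [mul_assoc]

theorem K_fst (p : ℂ) (w : Fin n → ℂ) (lo hi : List (Fin n)) (a b : Fin n) :
    Q.K p w lo a (b :: hi) = Q.X p w lo hi a b (w a) * Q.r a b lo.toFinset (w a - w b) := by
  simp only [K, X, P, mul_assoc]

theorem K_snd (p : ℂ) (w : Fin n → ℂ) (lo hi : List (Fin n)) (a b : Fin n) :
    Q.K p w (lo ++ [a]) b hi =
      Q.r b a lo.toFinset (w b - w a + p) * Q.X p w lo hi b a (w b) := by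
  have h : (lo ++ [a]).toFinset = insert a lo.toFinset := by ext; simp
  have h' : w b + p - w a = w b - w a + p := by ring
  simp only [K, X, P_append, P, mul_assoc, h, h', Finset.empty_union, one_mul]

/-- Moving `r a b` through the operator of a space on the left. -/
theorem K_left (p : ℂ) (w : Fin n → ℂ) (l1 l2 hi : List (Fin n)) (i a b : Fin n)
    (hn : (l1 ++ i :: (l2 ++ a :: b :: hi)).Nodup) :
    Q.r a b (l1 ++ i :: l2).toFinset (w a - w b) * Q.K p w l1 i (l2 ++ a :: b :: hi) =
    Q.K p w l1 i (l2 ++ b :: a :: hi) * Q.r a b (l1 ++ i :: l2).toFinset (w a - w b) := by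
  have hn0 := hn
  simp only [List.nodup_cons, List.mem_cons, List.mem_append, not_or, List.nodup_append] at hn
  obtain ⟨-, ⟨⟨hi2, hia, hib, hihi⟩, -, ⟨⟨hab, hahi⟩, hbhi, -⟩, h2⟩, h1⟩ := hn
  have ha1 : a ∉ l1 := fun h => h1 a h a (by simp) rfl
  have hb1 : b ∉ l1 := fun h => h1 b h b (by simp) rfl
  have hi1 : i ∉ l1 := fun h => h1 i h i (by simp) rfl
  have ha2 : a ∉ l2 := fun h => h2 a h a (by simp) rfl
  have hb2 : b ∉ l2 := fun h => h2 b h b (by simp) rfl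
  have hhi1 : ∀ m ∈ hi, m ∉ l1 := fun m hm h => h1 m h m (by simp [hm]) rfl
  have hhi2 : ∀ m ∈ hi, m ∉ l2 := fun m hm h => h2 m h m (by simp [hm]) rfl
  have eS : (l1 ++ i :: l2).toFinset = insert i (l1.toFinset ∪ l2.toFinset) := by
    ext
    simp only [Finset.mem_union, Finset.mem_insert, List.mem_toFinset, List.mem_cons,
      List.mem_append]
    tauto
  rw [eS]
  set S := l1.toFinset ∪ l2.toFinset with hS
  have hiS : i ∉ S := by simp [hS, hi1, hi2]
  have haS : a ∉ S := by simp [hS, ha1, ha2]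
  have hbS : b ∉ S := by simp [hS, hb1, hb2]
  simp only [K, P_append, P, ← hS]
  have c1 := Q.P_comm i a b (w i + p) w (w a - w b) l1 ∅ (insert i S) hia hib hab hi1 ha1 hb1
    (by intro m hm; simp [hS, hm]) (by simp)
  have c2 := Q.gr i a b S (w a - w b) hia hib hab hiS
  have c3 := Q.P_comm i a b (w i) w (w a - w b) hi (insert b (insert a S)) S hia hib hab hihi
    hahi hbhi (by intro m hm; simp [hS, hhi1 m hm, hhi2 m hm, hi1, hi2]) (by simp)
  have c4 := Q.yb i a b S (w i - w a) (w a - w b) hia hib hab hiS haS hbS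
  have c5 := Q.P_comm i a b (w i) w (w a - w b) l2 l1.toFinset (insert i S) hia hib hab hi2
    ha2 hb2 (by intro m hm; simp [hS, hm]) (by simp [ha1, hb1])
  have e4 : w i - w a + (w a - w b) = w i - w b := by ring
  rw [e4] at c4
  set r0 := Q.r a b (insert i S) (w a - w b)
  set r1 := Q.r a b S (w a - w b)
  rw [Finset.insert_comm a b S]
  set p1 := Q.P i (w i + p) w l1 ∅
  set p2 := Q.P i (w i) w hi (insert b (insert a S))
  set p3 := Q.P i (w i) w l2 l1.toFinset
  calc _ = (r0 * p1) * Q.g i * p2 * (Q.r i b (insert a S) (w i - w b) *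
        Q.r i a S (w i - w a)) * p3 := by simp only [mul_assoc]
    _ = p1 * (r0 * Q.g i) * p2 * (Q.r i b (insert a S) (w i - w b) *
        Q.r i a S (w i - w a)) * p3 := by rw [← c1]; simp only [mul_assoc]
    _ = p1 * Q.g i * (r1 * p2) * (Q.r i b (insert a S) (w i - w b) *
        Q.r i a S (w i - w a)) * p3 := by rw [← c2]; simp only [mul_assoc]
    _ = p1 * Q.g i * p2 * (r1 * Q.r i b (insert a S) (w i - w b) *
        Q.r i a S (w i - w a)) * p3 := by rw [← c3]; simp only [mul_assoc]
    _ = p1 * Q.g i * p2 * (Q.r i a (insert b S) (w i - w a) *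
        Q.r i b S (w i - w b)) * (r0 * p3) := by rw [← c4]; simp only [mul_assoc]
    _ = _ := by rw [← c5]; simp only [mul_assoc]

/-- Moving `r a b` through the operator of a space on the right. -/
theorem K_right (p : ℂ) (w : Fin n → ℂ) (lo h1 h2 : List (Fin n)) (i a b : Fin n)
    (hn : (lo ++ a :: b :: (h1 ++ i :: h2)).Nodup) :
    Q.r a b lo.toFinset (w a - w b) * Q.K p w (lo ++ a :: b :: h1) i h2 =
    Q.K p w (lo ++ b :: a :: h1) i h2 * Q.r a b lo.toFinset (w a - w b) := by
  simp only [List.nodup_cons, List.mem_cons, List.mem_append, not_or, List.nodup_append] at hn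
  obtain ⟨-, ⟨⟨hab, hah1, hai, hah2⟩, ⟨hbh1, hbi, hbh2⟩, -, ⟨hih2, -⟩, hh⟩, hl⟩ := hn
  have hia : i ≠ a := Ne.symm hai
  have hib : i ≠ b := Ne.symm hbi
  have halo : a ∉ lo := fun h => hl a h a (by simp) rfl
  have hblo : b ∉ lo := fun h => hl b h b (by simp) rfl
  have hilo : i ∉ lo := fun h => hl i h i (by simp) rfl
  have hih1 : i ∉ h1 := fun h => hh i h i (by simp) rfl
  have hlo1 : ∀ m ∈ h1, m ∉ lo := fun m hm h => hl m h m (by simp [hm]) rfl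
  have hlo2 : ∀ m ∈ h2, m ∉ lo := fun m hm h => hl m h m (by simp [hm]) rfl
  have eS : (lo ++ b :: a :: h1).toFinset = (lo ++ a :: b :: h1).toFinset := by
    ext; simp; tauto
  simp only [K, P_append, P, eS, Finset.empty_union]
  set S := lo.toFinset with hS
  have hiS : i ∉ S := by simp [hS, hilo]
  have haS : a ∉ S := by simp [hS, halo]
  have hbS : b ∉ S := by simp [hS, hblo]
  have c1 := Q.P_comm i a b (w i + p) w (w a - w b) h1 (insert b (insert a S)) S hia hib hab
    hih1 hah1 hbh1 (by intro m hm; simp [hS, hlo1 m hm, hilo]) (by simp)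
  have c4 := Q.yb i a b S (w i + p - w a) (w a - w b) hia hib hab hiS haS hbS
  have e4 : w i + p - w a + (w a - w b) = w i + p - w b := by ring
  rw [e4] at c4
  have c5 := Q.P_comm i a b (w i + p) w (w a - w b) lo ∅ (insert i S) hia hib hab hilo
    halo hblo (by intro m hm; simp [hS, hm]) (by simp)
  have c2 := Q.gr i a b S (w a - w b) hia hib hab hiS
  have c3 := Q.P_comm i a b (w i) w (w a - w b) h2 (lo ++ a :: b :: h1).toFinset S hia hib hab
    hih2 hah2 hbh2 (by intro m hm; simp [hS, hlo2 m hm, hilo]) (by simp)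
  set r0 := Q.r a b (insert i S) (w a - w b)
  set r1 := Q.r a b S (w a - w b)
  rw [Finset.insert_comm a b S]
  set p1 := Q.P i (w i + p) w lo ∅
  set p2 := Q.P i (w i + p) w h1 (insert b (insert a S))
  set p3 := Q.P i (w i) w h2 (lo ++ a :: b :: h1).toFinset
  calc _ = (r1 * p2) * (Q.r i b (insert a S) (w i + p - w b) *
        Q.r i a S (w i + p - w a)) * p1 * Q.g i * p3 := by simp only [mul_assoc]
    _ = p2 * (r1 * Q.r i b (insert a S) (w i + p - w b) *
        Q.r i a S (w i + p - w a)) * p1 * Q.g i * p3 := by rw [← c1]; simp only [mul_assoc]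
    _ = p2 * (Q.r i a (insert b S) (w i + p - w a) *
        Q.r i b S (w i + p - w b)) * (r0 * p1) * Q.g i * p3 := by
        rw [← c4]; simp only [mul_assoc]
    _ = p2 * (Q.r i a (insert b S) (w i + p - w a) *
        Q.r i b S (w i + p - w b)) * p1 * (r0 * Q.g i) * p3 := by
        rw [← c5]; simp only [mul_assoc]
    _ = p2 * (Q.r i a (insert b S) (w i + p - w a) *
        Q.r i b S (w i + p - w b)) * p1 * Q.g i * (r1 * p3) := by
        rw [← c2]; simp only [mul_assoc]
    _ = _ := by rw [← c3]; simp only [mul_assoc]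

end QSys

/-! ### The rigidity argument -/

section Rigid

variable {M W : Type*} [AddCommGroup M] [Module ℂ M] [AddCommGroup W] [Module ℂ W]
  (ev : ℂ → M →ₗ[ℂ] W)

/-- The value of `Y f` at a point depends on finitely many values of `f`. -/
def LocOp (Y : Module.End ℂ M) : Prop :=
  ∀ lam, ∃ T : Finset ℂ, ∀ f, (∀ μ ∈ T, ev μ f = 0) → ev lam (Y f) = 0

/-- Multiplication operators. -/
def PtOp (Y : Module.End ℂ M) : Prop :=
  ∀ lam, ∃ m : Module.End ℂ W, ∀ f, ev lam (Y f) = m (ev lam f)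

variable {ev}

theorem PtOp.loc {Y : Module.End ℂ M} (h : PtOp ev Y) : LocOp ev Y := by
  intro lam
  obtain ⟨m, hm⟩ := h lam
  exact ⟨{lam}, fun f hf => by rw [hm, hf lam (by simp), map_zero]⟩

theorem PtOp.mul {Y Z : Module.End ℂ M} (h : PtOp ev Y) (h' : PtOp ev Z) : PtOp ev (Y * Z) := by
  intro lam
  obtain ⟨m, hm⟩ := h lam
  obtain ⟨m', hm'⟩ := h' lam
  exact ⟨m * m', fun f => by simp [hm, hm']⟩

theorem LocOp.one : LocOp ev (1 : Module.End ℂ M) :=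
  fun lam => ⟨{lam}, fun f hf => hf lam (by simp)⟩

theorem LocOp.mul {Y Z : Module.End ℂ M} (h : LocOp ev Y) (h' : LocOp ev Z) :
    LocOp ev (Y * Z) := by
  classical
  intro lam
  obtain ⟨T, hT⟩ := h lam
  choose U hU using h'
  refine ⟨T.biUnion U, fun f hf => hT _ fun μ hμ => hU μ f fun ν hν => hf ν ?_⟩
  exact Finset.mem_biUnion.2 ⟨μ, hμ, hν⟩

theorem PtOp.aeval {t : Module.End ℂ M} (lam : ℂ) (m : Module.End ℂ W)
    (hm : ∀ f, ev lam (t f) = m (ev lam f)) (q : Polynomial ℂ) (f : M) :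
    ev lam (Polynomial.aeval t q f) = Polynomial.aeval m q (ev lam f) := by
  induction q using Polynomial.induction_on' with
  | add p q hp hq => simp [hp, hq]
  | monomial k c =>
    have : ∀ k f, ev lam ((t ^ k) f) = (m ^ k) (ev lam f) := by
      intro k
      induction k with
      | zero => simp
      | succ k ih => intro f; rw [pow_succ, pow_succ, Module.End.mul_apply, ih, hm]; rfl
    simp [Polynomial.aeval_monomial, this, Module.algebraMap_end_apply]

theorem PtOp.exists_poly [FiniteDimensional ℂ W] {t : Module.End ℂ M} (h : PtOp ev t)
    (T : Finset ℂ) :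
    ∃ q : Polynomial ℂ, q.Monic ∧ ∀ f, ∀ μ ∈ T, ev μ (Polynomial.aeval t q f) = 0 := by
  choose m hm using h
  refine ⟨∏ μ ∈ T, (m μ).charpoly, Polynomial.monic_prod_of_monic _ _
    (fun μ _ => LinearMap.charpoly_monic _), fun f μ hμ => ?_⟩
  rw [PtOp.aeval μ (m μ) (hm μ), ← Finset.mul_prod_erase T _ hμ, map_mul,
    LinearMap.aeval_self_charpoly]
  simp

theorem rigid_seq [FiniteDimensional ℂ W] (t t' : Module.End ℂ M) (ht : PtOp ev t)
    (ht' : PtOp ev t') (hinj : ∀ f : M, (∀ lam, ev lam f = 0) → f = 0)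
    (χ χ' : ℤ → M) (s s' Y : ℤ → Module.End ℂ M)
    (hχ : ∀ k, χ (k + 1) = s k (t (χ k))) (hχ' : ∀ k, χ' (k + 1) = s' k (t' (χ' k)))
    (hY : ∀ k, Y k (χ k) = χ' k) (hs : ∀ k, s k * t = t * s k)
    (hs' : ∀ k, s' k * t' = t' * s' k) (hYs : ∀ k, Y (k + 1) * s k = s' k * Y k)
    (hloc : ∀ k, LocOp ev (Y k)) : Y 0 (t (χ 0)) = t' (χ' 0) := by
  rw [← sub_eq_zero]
  apply hinj
  intro lam
  obtain ⟨T, hT⟩ := hloc 0 lam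
  obtain ⟨q1, hq1, h1⟩ := ht.exists_poly T
  obtain ⟨q2, hq2, h2⟩ := ht'.exists_poly {lam}
  set q := Polynomial.X * (q1 * q2) with hq
  have hqm : q.Monic := Polynomial.monic_X.mul (hq1.mul hq2)
  have hdeg : q.natDegree = (q1 * q2).natDegree + 1 := by
    rw [hq, Polynomial.natDegree_X_mul (hq1.mul hq2).ne_zero]
  set N := (q1 * q2).natDegree
  let D : ℤ → ℕ → M := fun k m => Y k ((t ^ m) (χ k)) - (t' ^ m) (χ' k)
  have hD0 : ∀ k, D k 0 = 0 := by intro k; simp [D, hY]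
  have hst : ∀ k m f, s k ((t ^ m) f) = (t ^ m) (s k f) := fun k m f =>
    LinearMap.congr_fun (show s k * t ^ m = t ^ m * s k from (Commute.pow_right (hs k) m)) f
  have hst' : ∀ k m f, s' k ((t' ^ m) f) = (t' ^ m) (s' k f) := fun k m f =>
    LinearMap.congr_fun
      (show s' k * t' ^ m = t' ^ m * s' k from (Commute.pow_right (hs' k) m)) f
  have hYs' : ∀ k f, s' k (Y k f) = Y (k + 1) (s k f) := fun k f =>
    (LinearMap.congr_fun (hYs k) f).symm
  have hD : ∀ k m, s' k (D k (m + 1)) = D (k + 1) m := by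
    intro k m
    simp only [D, map_sub, hYs', pow_succ, Module.End.mul_apply, hst, hst', hχ, hχ']
  let Φ : ℤ → ℕ → Module.End ℂ M := fun k L =>
    Nat.rec 1 (fun L φ => s' (k + L) * φ) L
  let Φ0 : ℤ → ℕ → Module.End ℂ M := fun k L =>
    Nat.rec 1 (fun L φ => s (k + L) * φ) L
  have hΦs : ∀ k L f, Φ k (L + 1) f = s' (k + L) (Φ k L f) := fun k L f => rfl
  have hΦ0s : ∀ k L f, Φ0 k (L + 1) f = s (k + L) (Φ0 k L f) := fun k L f => rfl
  have hΦ : ∀ k L m, Φ k L (D k (m + L)) = D (k + L) m := by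
    intro k L
    induction L with
    | zero => intro m; simp [Φ]
    | succ L ih =>
      intro m
      rw [hΦs, show m + (L + 1) = (m + 1) + L by ring, ih, hD]
      push_cast; rw [add_assoc]
  have hΦz : ∀ k L m, m ≤ L → Φ k L (D k m) = 0 := by
    intro k L
    induction L with
    | zero =>
      intro m hm
      obtain rfl : m = 0 := by omega
      rw [hD0, map_zero]
    | succ L ih =>
      intro m hm
      rcases Nat.lt_or_ge L m with h | h
      · obtain rfl : m = 0 + (L + 1) := by omega
        have := hΦ k (L + 1) 0
        rw [this, hD0]
      · rw [hΦs, ih m h, map_zero]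
  have hΦe : ∀ k L m, Φ k L (D k m) =
      Y (k + L) ((t ^ m) (Φ0 k L (χ k))) - (t' ^ m) (Φ k L (χ' k)) := by
    intro k L m
    induction L with
    | zero => simp [Φ, Φ0, D]
    | succ L ih =>
      rw [hΦs, ih, map_sub, hYs', hst, hst', hΦs, hΦ0s]
      push_cast; rw [add_assoc]
  set k0 : ℤ := -(N : ℤ) with hk0
  have hk : k0 + (N : ℤ) = 0 := by omega
  set ξ := Φ0 k0 N (χ k0)
  set ξ' := Φ k0 N (χ' k0)
  have hfin : Y 0 (t (χ 0)) - t' (χ' 0) = Φ k0 N (D k0 (N + 1)) := by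
    rw [add_comm, hΦ, hk]; simp [D]
  have hzero : ev lam (Y 0 (Polynomial.aeval t q ξ) - Polynomial.aeval t' q ξ') = 0 := by
    rw [map_sub, hT, zero_sub, neg_eq_zero]
    · rw [show q = q2 * (Polynomial.X * q1) by rw [hq]; ring, map_mul, Module.End.mul_apply]
      exact h2 _ lam (by simp)
    · intro μ hμ
      rw [show q = q1 * (Polynomial.X * q2) by rw [hq]; ring, map_mul, Module.End.mul_apply]
      exact h1 _ μ hμ
  have hexp : Y 0 (Polynomial.aeval t q ξ) - Polynomial.aeval t' q ξ' =
      ∑ m ∈ Finset.range (N + 2), q.coeff m • Φ k0 N (D k0 m) := by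
    rw [Polynomial.aeval_eq_sum_range, Polynomial.aeval_eq_sum_range, hdeg]
    simp only [LinearMap.sum_apply, map_sum, LinearMap.smul_apply, map_smul, hΦe, hk,
      ← Finset.sum_sub_distrib, smul_sub]
    rfl
  rw [Finset.sum_range_succ, Finset.sum_eq_zero, zero_add] at hexp
  · have : q.coeff (N + 1) = 1 := by rw [← hdeg]; exact hqm
    rw [this, one_smul] at hexp
    rw [hfin, ← hexp, hzero]
  · intro m hm
    rw [hΦz, smul_zero]
    have := Finset.mem_range.1 hm
    omega

theorem rigid [FiniteDimensional ℂ W] (hinj : ∀ f : M, (∀ lam, ev lam f = 0) → f = 0)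
    (p : ℂ) (X1 X2 r12 r21 : ℂ → Module.End ℂ M) (ψ : ℂ → ℂ → M)
    (h1 : ∀ v1 v2, ψ (v1 + p) v2 = X1 v1 (r12 (v1 - v2) (ψ v1 v2)))
    (h2 : ∀ v1 v2, ψ v1 (v2 + p) = r21 (v2 - v1 + p) (X2 v2 (ψ v1 v2)))
    (hX12 : ∀ v1 v2, X2 v2 * X1 v1 * r12 (v1 - v2) = r12 (v1 - v2) * (X1 v1 * X2 v2))
    (hX21 : ∀ v1 v2, X1 v1 * X2 v2 * r21 (v2 - v1) = r21 (v2 - v1) * (X2 v2 * X1 v1))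
    (hp12 : ∀ u, PtOp ev (r12 u)) (hp21 : ∀ u, PtOp ev (r21 u)) (hl : ∀ v, LocOp ev (X2 v))
    (v1 v2 : ℂ) :
    X2 v2 (r21 (v2 - v1) (r12 (v1 - v2) (ψ v1 v2))) = r12 (v1 - v2 - p) (ψ v1 (v2 + p)) := by
  have hst : ∀ a b, X2 b * X1 a * (r12 (a - b) * r21 (b - a)) =
      r12 (a - b) * r21 (b - a) * (X2 b * X1 a) := by
    intro a b
    rw [← mul_assoc, hX12, mul_assoc, hX21, mul_assoc]
  have key := rigid_seq (ev := ev) (r12 (v1 - v2) * r21 (v2 - v1))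
    (r12 (v1 - v2 - p) * r21 (v2 - v1 + p))
    ((hp12 _).mul (hp21 _)) ((hp12 _).mul (hp21 _)) hinj
    (fun k => X2 (v2 - p + k * p) (ψ (v1 + k * p) (v2 - p + k * p)))
    (fun k => X2 (v2 + k * p) (ψ (v1 + k * p) (v2 + k * p)))
    (fun k => X2 (v2 + k * p) * X1 (v1 + k * p))
    (fun k => X2 (v2 + p + k * p) * X1 (v1 + k * p))
    (fun k => X2 (v2 + k * p) * r21 (v2 - v1))
    ?_ ?_ ?_ ?_ ?_ ?_ ?_
  · simp only [Int.cast_zero, zero_mul, add_zero, Module.End.mul_apply] at key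
    have e := h2 v1 (v2 - p)
    rw [show v2 - p + p = v2 by ring, show v2 - p - v1 + p = v2 - v1 by ring] at e
    rw [← e] at key
    rw [key, h2]
  · intro k
    have e1 : v2 - p + ((k + 1 : ℤ) : ℂ) * p = v2 + k * p := by push_cast; ring
    have e2 : v1 + ((k + 1 : ℤ) : ℂ) * p = v1 + k * p + p := by push_cast; ring
    have e := h2 (v1 + k * p) (v2 - p + k * p)
    rw [show v2 - p + k * p + p = v2 + k * p by ring,
      show v2 - p + k * p - (v1 + k * p) + p = v2 - v1 by ring] at e
    simp only [Module.End.mul_apply, e1, e2]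
    rw [← e, h1]
    congr 4; ring
  · intro k
    have e1 : v2 + ((k + 1 : ℤ) : ℂ) * p = v2 + p + k * p := by push_cast; ring
    have e2 : v1 + ((k + 1 : ℤ) : ℂ) * p = v1 + k * p + p := by push_cast; ring
    have e := h2 (v1 + k * p) (v2 + k * p)
    rw [show v2 + k * p + p = v2 + p + k * p by ring,
      show v2 + k * p - (v1 + k * p) + p = v2 - v1 + p by ring] at e
    simp only [Module.End.mul_apply, e1, e2]
    rw [← e, h1]
    congr 4; ring
  · intro k
    have e := h2 (v1 + k * p) (v2 - p + k * p)
    rw [show v2 - p + k * p + p = v2 + k * p by ring,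
      show v2 - p + k * p - (v1 + k * p) + p = v2 - v1 by ring] at e
    simp only [Module.End.mul_apply]
    rw [← e]
  · intro k
    have := hst (v1 + k * p) (v2 + k * p)
    rwa [show v1 + k * p - (v2 + k * p) = v1 - v2 by ring,
      show v2 + k * p - (v1 + k * p) = v2 - v1 by ring] at this
  · intro k
    have := hst (v1 + k * p) (v2 + p + k * p)
    rwa [show v1 + k * p - (v2 + p + k * p) = v1 - v2 - p by ring,
      show v2 + p + k * p - (v1 + k * p) = v2 - v1 + p by ring] at this
  · intro k
    have e1 : v2 + ((k + 1 : ℤ) : ℂ) * p = v2 + p + k * p := by push_cast; ring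
    have := hX21 (v1 + k * p) (v2 + k * p)
    rw [show v2 + k * p - (v1 + k * p) = v2 - v1 by ring] at this
    simp only [e1]
    rw [mul_assoc, ← this]
    simp only [mul_assoc]
  · intro k
    exact (hl _).mul (hp21 _).loc

end Rigid

/-! ### The concrete operators -/

section Concrete

variable {n : ℕ} {B : Fin n → Type*} [∀ i, Fintype (B i)] [∀ i, DecidableEq (B i)]

/-- Total weight of the factors in `S`. -/
noncomputable def wsum (wt : ∀ i, B i → ℂ) (S : Finset (Fin n)) (b : ∀ i, B i) : ℂ :=
  ∑ i ∈ S, wt i (b i)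


/-- R-operator with arbitrary dynamical shift. -/
noncomputable def Rraw (wt : ∀ i, B i → ℂ) (η : ℂ)
    (R : ∀ k l : Fin n, ℂ → ℂ → (B k × B l) → (B k × B l) → ℂ)
    (k l : Fin n) (S : Finset (Fin n)) (u : ℂ) : Module.End ℂ (ℂ → (∀ i, B i) → ℂ) where
  toFun f := fun lam b => ∑ c : B k × B l,
    R k l u (lam - 2 * η * wsum wt S b) (b k, b l) c *
      f lam (Function.update (Function.update b k c.1) l c.2)
  map_add' f g := by
    funext lam b
    simp only [Pi.add_apply, mul_add, Finset.sum_add_distrib]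
  map_smul' a f := by
    funext lam b
    simp only [Pi.smul_apply, smul_eq_mul, Finset.mul_sum, RingHom.id_apply]
    exact Finset.sum_congr rfl fun c _ => by ring

/-- Shift operator. -/
noncomputable def Graw (wt : ∀ i, B i → ℂ) (η : ℂ) (a : Fin n) :
    Module.End ℂ (ℂ → (∀ i, B i) → ℂ) where
  toFun f := fun lam b => f (lam - 2 * η * wt a (b a)) b
  map_add' f g := rfl
  map_smul' a f := rfl

theorem Rraw_apply (wt : ∀ i, B i → ℂ) (η : ℂ)
    (R : ∀ k l : Fin n, ℂ → ℂ → (B k × B l) → (B k × B l) → ℂ)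
    (k l : Fin n) (S : Finset (Fin n)) (u : ℂ) (f : ℂ → (∀ i, B i) → ℂ) (lam : ℂ)
    (b : ∀ i, B i) :
    Rraw wt η R k l S u f lam b = ∑ c : B k × B l,
      R k l u (lam - 2 * η * wsum wt S b) (b k, b l) c *
        f lam (Function.update (Function.update b k c.1) l c.2) := rfl

theorem Graw_apply (wt : ∀ i, B i → ℂ) (η : ℂ) (a : Fin n)
    (f : ℂ → (∀ i, B i) → ℂ) (lam : ℂ) (b : ∀ i, B i) :
    Graw wt η a f lam b = f (lam - 2 * η * wt a (b a)) b := rfl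

theorem wsum_congr (wt : ∀ i, B i → ℂ) (S : Finset (Fin n)) (b b' : ∀ i, B i)
    (h : ∀ i ∈ S, b i = b' i) : wsum wt S b = wsum wt S b' :=
  Finset.sum_congr rfl fun i hi => by rw [h i hi]

theorem wsum_insert (wt : ∀ i, B i → ℂ) (S : Finset (Fin n)) (a : Fin n) (ha : a ∉ S)
    (b : ∀ i, B i) : wsum wt (insert a S) b = wt a (b a) + wsum wt S b :=
  Finset.sum_insert ha

theorem wsum_upd (wt : ∀ i, B i → ℂ) (S : Finset (Fin n)) (b : ∀ i, B i) (k l : Fin n)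
    (hkl : k ≠ l) (x : B k) (y : B l) (hS : k ∈ S ↔ l ∈ S)
    (hw : wt k (b k) + wt l (b l) = wt k x + wt l y) :
    wsum wt S (Function.update (Function.update b k x) l y) = wsum wt S b := by
  by_cases hk : k ∈ S
  · have hl := hS.1 hk
    have e : S = insert k (insert l ((S.erase k).erase l)) := by
      rw [Finset.insert_erase (Finset.mem_erase.2 ⟨hkl.symm, hl⟩), Finset.insert_erase hk]
    have e0 : wsum wt ((S.erase k).erase l) (Function.update (Function.update b k x) l y) =
        wsum wt ((S.erase k).erase l) b := by
      apply wsum_congr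
      intro i hi
      simp only [Finset.mem_erase] at hi
      rw [Function.update_of_ne hi.1, Function.update_of_ne hi.2.1]
    rw [e, wsum_insert _ _ _ (by simp [hkl]), wsum_insert _ _ _ (by simp),
      wsum_insert _ _ _ (by simp [hkl]), wsum_insert _ _ _ (by simp), e0,
      Function.update_self, Function.update_of_ne hkl, Function.update_self]
    linear_combination -hw
  · have hl : l ∉ S := fun h => hk (hS.2 h)
    apply wsum_congr
    intro i hi
    have hil : i ≠ l := by rintro rfl; exact hl hi
    have hik : i ≠ k := by rintro rfl; exact hk hi
    rw [Function.update_of_ne hil, Function.update_of_ne hik]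

theorem Rraw_comm (wt : ∀ i, B i → ℂ) (η : ℂ)
    (R : ∀ k l : Fin n, ℂ → ℂ → (B k × B l) → (B k × B l) → ℂ)
    (hzero : ∀ (k l : Fin n) (w lam : ℂ) (b c : B k × B l),
      wt k b.1 + wt l b.2 ≠ wt k c.1 + wt l c.2 → R k l w lam b c = 0)
    (a b c d : Fin n) (S S' : Finset (Fin n)) (u v : ℂ) (hab : a ≠ b) (hcd : c ≠ d)
    (hac : a ≠ c) (had : a ≠ d) (hbc : b ≠ c) (hbd : b ≠ d) (h1 : a ∈ S' ↔ b ∈ S')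
    (h2 : c ∈ S ↔ d ∈ S) (f : ℂ → (∀ i, B i) → ℂ) :
    Rraw wt η R a b S u (Rraw wt η R c d S' v f) =
      Rraw wt η R c d S' v (Rraw wt η R a b S u f) := by
  funext lam x
  simp only [Rraw_apply, Finset.mul_sum]
  rw [Finset.sum_comm]
  refine Finset.sum_congr rfl fun y _ => Finset.sum_congr rfl fun z _ => ?_
  simp only [Function.update_of_ne hac.symm, Function.update_of_ne had.symm,
    Function.update_of_ne hbc.symm, Function.update_of_ne hbd.symm, Function.update_of_ne hac,
    Function.update_of_ne had, Function.update_of_ne hbc, Function.update_of_ne hbd]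
  have eu : Function.update (Function.update (Function.update (Function.update x a z.1) b z.2)
      c y.1) d y.2 = Function.update (Function.update (Function.update (Function.update x c y.1)
      d y.2) a z.1) b z.2 := by
    rw [Function.update_comm hbc, Function.update_comm hac, Function.update_comm hbd,
      Function.update_comm had]
  rw [eu]
  by_cases hz : wt a (x a) + wt b (x b) = wt a z.1 + wt b z.2
  · by_cases hy : wt c (x c) + wt d (x d) = wt c y.1 + wt d y.2
    · rw [wsum_upd wt S' x a b hab z.1 z.2 h1 hz, wsum_upd wt S x c d hcd y.1 y.2 h2 hy]
      ring
    · rw [hzero c d _ _ (x c, x d) y hy, hzero c d _ _ (x c, x d) y hy]; ring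
  · rw [hzero a b _ _ (x a, x b) z hz, hzero a b _ _ (x a, x b) z hz]; ring

/-- Update of three factors. -/
def upd3 (k l m : Fin n) (b : ∀ i, B i) (c : B k × B l × B m) : ∀ i, B i :=
  Function.update (Function.update (Function.update b k c.1) l c.2.1) m c.2.2

theorem upd3_fst (k l m : Fin n) (hkl : k ≠ l) (hkm : k ≠ m) (b : ∀ i, B i)
    (c : B k × B l × B m) : upd3 k l m b c k = c.1 := by
  simp [upd3, Function.update_of_ne hkl, Function.update_of_ne hkm]

theorem upd3_snd (k l m : Fin n) (hlm : l ≠ m) (b : ∀ i, B i)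
    (c : B k × B l × B m) : upd3 k l m b c l = c.2.1 := by
  simp [upd3, Function.update_of_ne hlm]

theorem upd3_trd (k l m : Fin n) (b : ∀ i, B i)
    (c : B k × B l × B m) : upd3 k l m b c m = c.2.2 := by
  simp [upd3]

theorem upd3_12 (k l m : Fin n) (hkl : k ≠ l) (hkm : k ≠ m) (hlm : l ≠ m) (b : ∀ i, B i)
    (c : B k × B l × B m) (x : B k) (y : B l) :
    Function.update (Function.update (upd3 k l m b c) k x) l y = upd3 k l m b (x, y, c.2.2) := by
  simp only [upd3]
  rw [Function.update_comm hkm.symm, Function.update_comm hlm.symm,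
    Function.update_comm hkl.symm, Function.update_idem, Function.update_idem]

theorem upd3_13 (k l m : Fin n) (hkl : k ≠ l) (hkm : k ≠ m) (b : ∀ i, B i)
    (c : B k × B l × B m) (x : B k) (y : B m) :
    Function.update (Function.update (upd3 k l m b c) k x) m y = upd3 k l m b (x, c.2.1, y) := by
  simp only [upd3]
  rw [Function.update_comm hkm.symm, Function.update_idem, Function.update_comm hkl.symm,
    Function.update_idem]

theorem upd3_23 (k l m : Fin n) (hlm : l ≠ m) (b : ∀ i, B i)
    (c : B k × B l × B m) (x : B l) (y : B m) :
    Function.update (Function.update (upd3 k l m b c) l x) m y = upd3 k l m b (c.1, x, y) := by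
  simp only [upd3]
  rw [Function.update_comm hlm.symm, Function.update_idem, Function.update_idem]

theorem wsum_upd3 (wt : ∀ i, B i → ℂ) (k l m : Fin n) (S : Finset (Fin n)) (hk : k ∉ S)
    (hl : l ∉ S) (hm : m ∉ S) (b : ∀ i, B i) (c : B k × B l × B m) :
    wsum wt S (upd3 k l m b c) = wsum wt S b := by
  apply wsum_congr
  intro i hi
  simp only [upd3]
  have him : i ≠ m := by rintro rfl; exact hm hi
  have hil : i ≠ l := by rintro rfl; exact hl hi
  have hik : i ≠ k := by rintro rfl; exact hk hi
  rw [Function.update_of_ne him, Function.update_of_ne hil, Function.update_of_ne hik]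

theorem act12 (wt : ∀ i, B i → ℂ) (η : ℂ)
    (R : ∀ k l : Fin n, ℂ → ℂ → (B k × B l) → (B k × B l) → ℂ)
    (k l m : Fin n) (hkl : k ≠ l) (hkm : k ≠ m) (hlm : l ≠ m) (S : Finset (Fin n)) (u : ℂ)
    (f : ℂ → (∀ i, B i) → ℂ) (lam : ℂ) (b : ∀ i, B i) (c : B k × B l × B m) (lamf : B m → ℂ)
    (h : lam - 2 * η * wsum wt S (upd3 k l m b c) = lamf c.2.2) :
    Rraw wt η R k l S u f lam (upd3 k l m b c) =
      ∑ d, T12 B R k l m u lamf c d * f lam (upd3 k l m b d) := by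
  rw [Rraw_apply]
  simp only [upd3_12 k l m hkl hkm hlm, h, upd3_fst k l m hkl hkm, upd3_snd k l m hlm, T12,
    Fintype.sum_prod_type, ite_mul, zero_mul, Finset.sum_ite_eq, Finset.mem_univ, if_true]

theorem act13 (wt : ∀ i, B i → ℂ) (η : ℂ)
    (R : ∀ k l : Fin n, ℂ → ℂ → (B k × B l) → (B k × B l) → ℂ)
    (k l m : Fin n) (hkl : k ≠ l) (hkm : k ≠ m) (S : Finset (Fin n)) (u : ℂ)
    (f : ℂ → (∀ i, B i) → ℂ) (lam : ℂ) (b : ∀ i, B i) (c : B k × B l × B m) (lamf : B l → ℂ)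
    (h : lam - 2 * η * wsum wt S (upd3 k l m b c) = lamf c.2.1) :
    Rraw wt η R k m S u f lam (upd3 k l m b c) =
      ∑ d, T13 B R k l m u lamf c d * f lam (upd3 k l m b d) := by
  rw [Rraw_apply]
  simp only [upd3_13 k l m hkl hkm, h, upd3_fst k l m hkl hkm, upd3_trd k l m, T13,
    Fintype.sum_prod_type]
  refine Finset.sum_congr rfl fun x _ => ?_
  rw [Finset.sum_comm]
  simp only [ite_mul, zero_mul, Finset.sum_ite_eq, Finset.mem_univ, if_true]

theorem act23 (wt : ∀ i, B i → ℂ) (η : ℂ)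
    (R : ∀ k l : Fin n, ℂ → ℂ → (B k × B l) → (B k × B l) → ℂ)
    (k l m : Fin n) (hlm : l ≠ m) (S : Finset (Fin n)) (u : ℂ)
    (f : ℂ → (∀ i, B i) → ℂ) (lam : ℂ) (b : ∀ i, B i) (c : B k × B l × B m) (lamf : B k → ℂ)
    (h : lam - 2 * η * wsum wt S (upd3 k l m b c) = lamf c.1) :
    Rraw wt η R l m S u f lam (upd3 k l m b c) =
      ∑ d, T23 B R k l m u lamf c d * f lam (upd3 k l m b d) := by
  rw [Rraw_apply]
  simp only [upd3_23 k l m hlm, h, upd3_snd k l m hlm, upd3_trd k l m, T23,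
    Fintype.sum_prod_type]
  symm
  rw [Finset.sum_comm]
  refine Finset.sum_congr rfl fun x _ => ?_
  rw [Finset.sum_comm]
  simp only [ite_mul, zero_mul, Finset.sum_ite_eq, Finset.mem_univ, if_true]

theorem Rraw_yb (wt : ∀ i, B i → ℂ) (η : ℂ)
    (R : ∀ k l : Fin n, ℂ → ℂ → (B k × B l) → (B k × B l) → ℂ)
    (hDYBE : ∀ (k l m' : Fin n) (u v lam : ℂ) (b c : B k × B l × B m'),
      (∑ d : B k × B l × B m', ∑ e : B k × B l × B m',
        T12 B R k l m' u (fun x => lam - 2 * η * wt m' x) b d *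
          T13 B R k l m' (u + v) (fun _ => lam) d e *
          T23 B R k l m' v (fun x => lam - 2 * η * wt k x) e c) =
      (∑ d : B k × B l × B m', ∑ e : B k × B l × B m',
        T23 B R k l m' v (fun _ => lam) b d *
          T13 B R k l m' (u + v) (fun x => lam - 2 * η * wt l x) d e *
          T12 B R k l m' u (fun _ => lam) e c))
    (k l m : Fin n) (S : Finset (Fin n)) (u v : ℂ) (hkl : k ≠ l) (hkm : k ≠ m) (hlm : l ≠ m)
    (hk : k ∉ S) (hl : l ∉ S) (hm : m ∉ S) (f : ℂ → (∀ i, B i) → ℂ) :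
    Rraw wt η R k l (insert m S) u (Rraw wt η R k m S (u + v) (Rraw wt η R l m (insert k S) v f)) =
      Rraw wt η R l m S v (Rraw wt η R k m (insert l S) (u + v) (Rraw wt η R k l S u f)) := by
  funext lam b
  have hb : b = upd3 k l m b (b k, b l, b m) := by
    simp [upd3]
  set c0 := (b k, b l, b m)
  rw [hb]
  set L := lam - 2 * η * wsum wt S b with hL
  have hw := wsum_upd3 wt k l m S hk hl hm b
  rw [act12 wt η R k l m hkl hkm hlm (insert m S) u _ lam b c0 (fun x => L - 2 * η * wt m x)
    (by rw [wsum_insert _ _ _ hm, hw, upd3_trd, hL]; ring)]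
  rw [act23 wt η R k l m hlm S v _ lam b c0 (fun _ => L) (by rw [hw])]
  have l1 : ∀ d, Rraw wt η R k m S (u + v) (Rraw wt η R l m (insert k S) v f) lam
      (upd3 k l m b d) = ∑ e, T13 B R k l m (u + v) (fun _ => L) d e *
        ∑ c, T23 B R k l m v (fun x => L - 2 * η * wt k x) e c * f lam (upd3 k l m b c) := by
    intro d
    rw [act13 wt η R k l m hkl hkm S (u + v) _ lam b d (fun _ => L) (by rw [hw])]
    refine Finset.sum_congr rfl fun e _ => ?_
    rw [act23 wt η R k l m hlm (insert k S) v _ lam b e (fun x => L - 2 * η * wt k x)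
      (by rw [wsum_insert _ _ _ hk, hw, upd3_fst k l m hkl hkm, hL]; ring)]
  have l2 : ∀ d, Rraw wt η R k m (insert l S) (u + v) (Rraw wt η R k l S u f) lam
      (upd3 k l m b d) = ∑ e, T13 B R k l m (u + v) (fun x => L - 2 * η * wt l x) d e *
        ∑ c, T12 B R k l m u (fun _ => L) e c * f lam (upd3 k l m b c) := by
    intro d
    rw [act13 wt η R k l m hkl hkm (insert l S) (u + v) _ lam b d (fun x => L - 2 * η * wt l x)
      (by rw [wsum_insert _ _ _ hl, hw, upd3_snd k l m hlm, hL]; ring)]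
    refine Finset.sum_congr rfl fun e _ => ?_
    rw [act12 wt η R k l m hkl hkm hlm S u _ lam b e (fun _ => L) (by rw [hw])]
  simp only [l1, l2]
  have gen : ∀ (P Q W : B k × B l × B m → B k × B l × B m → ℂ) (φ : B k × B l × B m → ℂ),
      ∑ d, P c0 d * ∑ e, Q d e * ∑ c, W e c * φ c =
        ∑ c, (∑ d, ∑ e, P c0 d * Q d e * W e c) * φ c := by
    intro P Q W φ
    simp only [Finset.mul_sum, Finset.sum_mul]
    symm
    rw [Finset.sum_comm]
    refine Finset.sum_congr rfl fun d _ => ?_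
    rw [Finset.sum_comm]
    exact Finset.sum_congr rfl fun e _ => Finset.sum_congr rfl fun c _ => by ring
  rw [gen, gen]
  exact Finset.sum_congr rfl fun c _ => by rw [hDYBE]

theorem Graw_Rraw (wt : ∀ i, B i → ℂ) (η : ℂ)
    (R : ∀ k l : Fin n, ℂ → ℂ → (B k × B l) → (B k × B l) → ℂ)
    (a k l : Fin n) (S : Finset (Fin n)) (u : ℂ) (hak : a ≠ k) (hal : a ≠ l) (ha : a ∉ S)
    (f : ℂ → (∀ i, B i) → ℂ) :
    Graw wt η a (Rraw wt η R k l S u f) = Rraw wt η R k l (insert a S) u (Graw wt η a f) := by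
  funext lam b
  simp only [Graw_apply, Rraw_apply, wsum_insert _ _ _ ha, Function.update_of_ne hak,
    Function.update_of_ne hal]
  refine Finset.sum_congr rfl fun c _ => ?_
  congr 2; ring

theorem Graw_Graw (wt : ∀ i, B i → ℂ) (η : ℂ) (a b : Fin n) (f : ℂ → (∀ i, B i) → ℂ) :
    Graw wt η a (Graw wt η b f) = Graw wt η b (Graw wt η a f) := by
  funext lam x
  simp only [Graw_apply]
  congr 1; ring

theorem GG_Rraw (wt : ∀ i, B i → ℂ) (η : ℂ)
    (R : ∀ k l : Fin n, ℂ → ℂ → (B k × B l) → (B k × B l) → ℂ)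
    (hzero : ∀ (k l : Fin n) (w lam : ℂ) (b c : B k × B l),
      wt k b.1 + wt l b.2 ≠ wt k c.1 + wt l c.2 → R k l w lam b c = 0)
    (k l : Fin n) (S : Finset (Fin n)) (u : ℂ) (hkl : k ≠ l) (hk : k ∉ S) (hl : l ∉ S)
    (f : ℂ → (∀ i, B i) → ℂ) :
    Graw wt η k (Graw wt η l (Rraw wt η R k l S u f)) =
      Rraw wt η R k l (insert k (insert l S)) u (Graw wt η k (Graw wt η l f)) := by
  funext lam b
  simp only [Graw_apply, Rraw_apply, wsum_insert wt (insert l S) k (by simp [hkl, hk]),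
    wsum_insert wt S l hl]
  refine Finset.sum_congr rfl fun c _ => ?_
  rw [Function.update_self, Function.update_of_ne hkl, Function.update_self]
  by_cases hc : wt k (b k) + wt l (b l) = wt k c.1 + wt l c.2
  · congr 2
    · ring
    · linear_combination (-2 * η) * hc
  · rw [hzero k l _ _ (b k, b l) c hc, hzero k l _ _ (b k, b l) c hc]; ring

/-- The zero weight functions. -/
def F0 (wt : ∀ i, B i → ℂ) : Submodule ℂ (ℂ → (∀ i, B i) → ℂ) where
  carrier := {f | ∀ lam b, (∑ i, wt i (b i)) ≠ 0 → f lam b = 0}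
  add_mem' hf hg lam b h := by simp [hf lam b h, hg lam b h]
  zero_mem' lam b h := rfl
  smul_mem' a f hf lam b h := by simp [hf lam b h]

theorem Rraw_mem (wt : ∀ i, B i → ℂ) (η : ℂ)
    (R : ∀ k l : Fin n, ℂ → ℂ → (B k × B l) → (B k × B l) → ℂ)
    (hzero : ∀ (k l : Fin n) (w lam : ℂ) (b c : B k × B l),
      wt k b.1 + wt l b.2 ≠ wt k c.1 + wt l c.2 → R k l w lam b c = 0)
    (k l : Fin n) (S : Finset (Fin n)) (u : ℂ) (hkl : k ≠ l) (f : ℂ → (∀ i, B i) → ℂ)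
    (hf : f ∈ F0 wt) : Rraw wt η R k l S u f ∈ F0 wt := by
  intro lam b h
  rw [Rraw_apply]
  refine Finset.sum_eq_zero fun c _ => ?_
  by_cases hc : wt k (b k) + wt l (b l) = wt k c.1 + wt l c.2
  · rw [hf, mul_zero]
    have := wsum_upd wt Finset.univ b k l hkl c.1 c.2 (by simp) hc
    simp only [wsum] at this
    rwa [this]
  · rw [hzero k l _ _ (b k, b l) c hc, zero_mul]

theorem Graw_mem (wt : ∀ i, B i → ℂ) (η : ℂ) (a : Fin n) (f : ℂ → (∀ i, B i) → ℂ)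
    (hf : f ∈ F0 wt) : Graw wt η a f ∈ F0 wt :=
  fun _ b h => hf _ b h

open Classical in
/-- Restriction to zero weight functions (used for `k ≠ l` only). -/
noncomputable def R0 (wt : ∀ i, B i → ℂ) (η : ℂ)
    (R : ∀ k l : Fin n, ℂ → ℂ → (B k × B l) → (B k × B l) → ℂ)
    (hzero : ∀ (k l : Fin n) (w lam : ℂ) (b c : B k × B l),
      wt k b.1 + wt l b.2 ≠ wt k c.1 + wt l c.2 → R k l w lam b c = 0)
    (k l : Fin n) (S : Finset (Fin n)) (u : ℂ) : Module.End ℂ (F0 wt) :=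
  if h : k ≠ l then
    (Rraw wt η R k l S u).restrict (fun f hf => Rraw_mem wt η R hzero k l S u h f hf) else 0

/-- Restriction of the shift to zero weight functions. -/
noncomputable def G0 (wt : ∀ i, B i → ℂ) (η : ℂ) (a : Fin n) : Module.End ℂ (F0 wt) :=
  (Graw wt η a).restrict (fun f hf => Graw_mem wt η a f hf)

theorem R0_coe (wt : ∀ i, B i → ℂ) (η : ℂ)
    (R : ∀ k l : Fin n, ℂ → ℂ → (B k × B l) → (B k × B l) → ℂ)
    (hzero : ∀ (k l : Fin n) (w lam : ℂ) (b c : B k × B l),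
      wt k b.1 + wt l b.2 ≠ wt k c.1 + wt l c.2 → R k l w lam b c = 0)
    (k l : Fin n) (S : Finset (Fin n)) (u : ℂ) (h : k ≠ l) (f : F0 wt) :
    (R0 wt η R hzero k l S u f : ℂ → (∀ i, B i) → ℂ) = Rraw wt η R k l S u f := by
  simp [R0, h]

theorem G0_coe (wt : ∀ i, B i → ℂ) (η : ℂ) (a : Fin n) (f : F0 wt) :
    (G0 wt η a f : ℂ → (∀ i, B i) → ℂ) = Graw wt η a f := rfl

/-- The system of operators on zero weight functions. -/
noncomputable def sys (wt : ∀ i, B i → ℂ) (η : ℂ)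
    (R : ∀ k l : Fin n, ℂ → ℂ → (B k × B l) → (B k × B l) → ℂ)
    (hzero : ∀ (k l : Fin n) (w lam : ℂ) (b c : B k × B l),
      wt k b.1 + wt l b.2 ≠ wt k c.1 + wt l c.2 → R k l w lam b c = 0)
    (hDYBE : ∀ (k l m' : Fin n) (u v lam : ℂ) (b c : B k × B l × B m'),
      (∑ d : B k × B l × B m', ∑ e : B k × B l × B m',
        T12 B R k l m' u (fun x => lam - 2 * η * wt m' x) b d *
          T13 B R k l m' (u + v) (fun _ => lam) d e *
          T23 B R k l m' v (fun x => lam - 2 * η * wt k x) e c) =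
      (∑ d : B k × B l × B m', ∑ e : B k × B l × B m',
        T23 B R k l m' v (fun _ => lam) b d *
          T13 B R k l m' (u + v) (fun x => lam - 2 * η * wt l x) d e *
          T12 B R k l m' u (fun _ => lam) e c)) :
    QSys n (Module.End ℂ (F0 wt)) where
  r := R0 wt η R hzero
  g := G0 wt η
  yb k l m S u v hkl hkm hlm hk hl hm := by
    ext1 f; apply Subtype.ext
    simp only [Module.End.mul_apply, R0_coe wt η R hzero _ _ _ _ hkl,
      R0_coe wt η R hzero _ _ _ _ hkm, R0_coe wt η R hzero _ _ _ _ hlm]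
    exact Rraw_yb wt η R hDYBE k l m S u v hkl hkm hlm hk hl hm f
  comm a b c d S S' u v hab hcd hac had hbc hbd h1 h2 := by
    ext1 f; apply Subtype.ext
    simp only [Module.End.mul_apply, R0_coe wt η R hzero _ _ _ _ hab,
      R0_coe wt η R hzero _ _ _ _ hcd]
    exact Rraw_comm wt η R hzero a b c d S S' u v hab hcd hac had hbc hbd h1 h2 f
  gr a k l S u hak hal hkl ha := by
    ext1 f; apply Subtype.ext
    simp only [Module.End.mul_apply, R0_coe wt η R hzero _ _ _ _ hkl, G0_coe]
    exact Graw_Rraw wt η R a k l S u hak hal ha f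
  gg a b := by
    ext1 f; apply Subtype.ext
    simp only [Module.End.mul_apply, G0_coe]
    exact Graw_Graw wt η a b f
  ggr k l S u hkl hk hl := by
    ext1 f; apply Subtype.ext
    simp only [Module.End.mul_apply, R0_coe wt η R hzero _ _ _ _ hkl, G0_coe]
    exact GG_Rraw wt η R hzero k l S u hkl hk hl f
  runiv k l u := by
    by_cases h : k = l
    · simp [R0, h]
    ext1 f; apply Subtype.ext
    funext lam b
    by_cases hb : ∑ i, wt i (b i) = 0
    · simp only [R0_coe wt η R hzero _ _ _ _ h, Rraw_apply, wsum, hb, Finset.sum_empty]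
    · rw [(R0 wt η R hzero k l Finset.univ u f).2 lam b hb,
        (R0 wt η R hzero k l ∅ u f).2 lam b hb]

/-- Evaluation. -/
def ev0 (wt : ∀ i, B i → ℂ) (lam : ℂ) : F0 wt →ₗ[ℂ] ((∀ i, B i) → ℂ) where
  toFun f := f.1 lam
  map_add' _ _ := rfl
  map_smul' _ _ := rfl

theorem R0_pt (wt : ∀ i, B i → ℂ) (η : ℂ)
    (R : ∀ k l : Fin n, ℂ → ℂ → (B k × B l) → (B k × B l) → ℂ)
    (hzero : ∀ (k l : Fin n) (w lam : ℂ) (b c : B k × B l),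
      wt k b.1 + wt l b.2 ≠ wt k c.1 + wt l c.2 → R k l w lam b c = 0)
    (k l : Fin n) (S : Finset (Fin n)) (u : ℂ) :
    PtOp (ev0 wt) (R0 wt η R hzero k l S u) := by
  intro lam
  by_cases h : k = l
  · exact ⟨0, fun f => by simp [R0, h]⟩
  refine ⟨{ toFun := fun φ b => ∑ c : B k × B l,
              R k l u (lam - 2 * η * wsum wt S b) (b k, b l) c *
                φ (Function.update (Function.update b k c.1) l c.2)
            map_add' := ?_
            map_smul' := ?_ }, ?_⟩
  · intro f g
    funext b
    simp only [Pi.add_apply, mul_add, Finset.sum_add_distrib]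
  · intro a f
    funext b
    simp only [Pi.smul_apply, smul_eq_mul, Finset.mul_sum, RingHom.id_apply]
    exact Finset.sum_congr rfl fun c _ => by ring
  · intro f
    funext b
    simp only [ev0, LinearMap.coe_mk, AddHom.coe_mk, R0_coe wt η R hzero _ _ _ _ h]
    rfl

theorem G0_loc (wt : ∀ i, B i → ℂ) (η : ℂ) (a : Fin n) : LocOp (ev0 wt) (G0 wt η a) := by
  classical
  intro lam
  refine ⟨Finset.univ.image (fun x : B a => lam - 2 * η * wt a x), fun f hf => ?_⟩
  funext b
  exact congrFun (hf (lam - 2 * η * wt a (b a))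
    (Finset.mem_image.2 ⟨b a, Finset.mem_univ _, rfl⟩)) b

end Concrete

/-! ### The exchange relation for all operators -/

namespace QSys

variable {n : ℕ} {A : Type*} [Ring A] (Q : QSys n A)

theorem X_congr (p : ℂ) (w w' : Fin n → ℂ) (lo hi : List (Fin n)) (a b : Fin n) (v : ℂ)
    (h : ∀ l ∈ lo ++ hi, w l = w' l) : Q.X p w lo hi a b v = Q.X p w' lo hi a b v := by
  simp only [X]
  rw [Q.P_congr a _ w w' lo _ (fun l hl => h l (by simp [hl])),
    Q.P_congr a _ w w' hi _ (fun l hl => h l (by simp [hl]))]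

end QSys

theorem QSys.P_loc {n : ℕ} {M W : Type*} [AddCommGroup M] [Module ℂ M] [AddCommGroup W]
    [Module ℂ W] (ev : ℂ → M →ₗ[ℂ] W) (Q : QSys n (Module.End ℂ M))
    (hp : ∀ a b S u, PtOp ev (Q.r a b S u)) (a : Fin n) (v : ℂ) (w : Fin n → ℂ)
    (t : List (Fin n)) (S : Finset (Fin n)) : LocOp ev (Q.P a v w t S) := by
  induction t generalizing S with
  | nil => exact LocOp.one
  | cons l t ih => exact (ih _).mul (hp _ _ _ _).loc

theorem exchange_all {n : ℕ} {M W : Type*} [AddCommGroup M] [Module ℂ M] [AddCommGroup W]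
    [Module ℂ W] [FiniteDimensional ℂ W] (ev : ℂ → M →ₗ[ℂ] W)
    (hinj : ∀ f : M, (∀ lam, ev lam f = 0) → f = 0) (Q : QSys n (Module.End ℂ M))
    (hp : ∀ a b S u, PtOp ev (Q.r a b S u)) (hg : ∀ a, LocOp ev (Q.g a))
    (p : ℂ) (lo hi : List (Fin n)) (j j' : Fin n)
    (hn : (lo ++ j :: j' :: hi).Nodup) (hall : ∀ i, i ∈ lo ++ j :: j' :: hi)
    (Ψ : (Fin n → ℂ) → M)
    (hsol : ∀ x i y, lo ++ j :: j' :: hi = x ++ i :: y → ∀ w : Fin n → ℂ,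
      Ψ (Function.update w i (w i + p)) = Q.K p w x i y (Ψ w))
    (x : List (Fin n)) (i : Fin n) (y : List (Fin n)) (hxy : lo ++ j' :: j :: hi = x ++ i :: y)
    (w : Fin n → ℂ) :
    Q.r j j' lo.toFinset (Function.update w i (w i + p) j - Function.update w i (w i + p) j')
        (Ψ (Function.update w i (w i + p))) =
      Q.K p w x i y (Q.r j j' lo.toFinset (w j - w j') (Ψ w)) := by
  have hperm : (lo ++ j :: j' :: hi).Perm (j :: j' :: (lo ++ hi)) :=
    List.perm_middle.trans (List.Perm.cons _ List.perm_middle)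
  have hn1 : (j :: j' :: (lo ++ hi)).Nodup := hperm.nodup_iff.1 hn
  have hn2 : (j' :: j :: (lo ++ hi)).Nodup := (List.Perm.swap _ _ _).nodup_iff.1 hn1
  have hall1 : ∀ i, i ∈ j :: j' :: (lo ++ hi) := fun i => hperm.mem_iff.1 (hall i)
  have hall2 : ∀ i, i ∈ j' :: j :: (lo ++ hi) := fun i =>
    (List.Perm.swap _ _ _).mem_iff.1 (hall1 i)
  have hj : j ∉ lo ++ hi := fun h => (List.nodup_cons.1 hn1).1 (List.mem_cons_of_mem _ h)
  have hj' : j' ∉ lo ++ hi := fun h => (List.nodup_cons.1 hn2).1 (List.mem_cons_of_mem _ h)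
  have hjj : j ≠ j' := fun h => (List.nodup_cons.1 hn1).1 (by simp [h])
  have case2 : Q.r j j' lo.toFinset
        (Function.update w j' (w j' + p) j - Function.update w j' (w j' + p) j')
        (Ψ (Function.update w j' (w j' + p))) =
      Q.K p w lo j' (j :: hi) (Q.r j j' lo.toFinset (w j - w j') (Ψ w)) := by
    have hW : ∀ v1 v2, ∀ l ∈ lo ++ hi,
        Function.update (Function.update w j v1) j' v2 l = w l := by
      intro v1 v2 l hl
      have h1 : l ≠ j := by rintro rfl; exact hj hl
      have h2 : l ≠ j' := by rintro rfl; exact hj' hl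
      rw [Function.update_of_ne h2, Function.update_of_ne h1]
    have key := rigid (ev := ev) hinj p (Q.X p w lo hi j j') (Q.X p w lo hi j' j)
      (Q.r j j' lo.toFinset) (Q.r j' j lo.toFinset)
      (fun v1 v2 => Ψ (Function.update (Function.update w j v1) j' v2)) ?_ ?_ ?_ ?_
      (hp _ _ _) (hp _ _ _) ?_ (w j) (w j')
    · simp only [Function.update_eq_self] at key
      rw [Q.K_fst, Module.End.mul_apply, key, Function.update_self, Function.update_of_ne hjj]
      congr 2; ring
    · intro v1 v2
      have e := hsol lo j (j' :: hi) rfl (Function.update (Function.update w j v1) j' v2)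
      rw [Q.K_fst, Q.X_congr p _ w lo hi j j' _ (hW v1 v2), Function.update_self,
        Function.update_of_ne hjj, Function.update_self, Function.update_comm hjj.symm,
        Function.update_idem] at e
      exact e
    · intro v1 v2
      have e := hsol (lo ++ [j]) j' hi (by simp)
        (Function.update (Function.update w j v1) j' v2)
      rw [Q.K_snd, Q.X_congr p _ w lo hi j' j _ (hW v1 v2), Function.update_self,
        Function.update_of_ne hjj, Function.update_self, Function.update_idem] at e
      exact e
    · intro v1 v2
      exact Q.XX p w lo hi j j' v1 v2 hn1 hall1 _ rfl
    · intro v1 v2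
      exact Q.XX p w lo hi j' j v2 v1 hn2 hall2 _ rfl
    · intro v
      exact ((Q.P_loc ev hp _ _ _ _ _).mul (hg _)).mul (Q.P_loc ev hp _ _ _ _ _)
  rcases List.append_eq_append_iff.1 hxy with ⟨as, hx, hy⟩ | ⟨bs, hx, hy⟩
  · rcases as with _ | ⟨a1, _ | ⟨a2, h1⟩⟩
    · simp only [List.nil_append, List.cons.injEq, List.append_nil] at hx hy
      obtain ⟨rfl, rfl⟩ := hy
      subst hx
      exact case2
    · simp only [List.cons_append, List.nil_append, List.cons.injEq] at hy
      obtain ⟨rfl, rfl, rfl⟩ := hy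
      subst hx
      rw [Q.K_snd, hsol lo j (j' :: hi) rfl w, Q.K_fst, Function.update_self,
        Function.update_of_ne hjj.symm]
      simp only [Module.End.mul_apply]
      congr 2; ring
    · simp only [List.cons_append, List.cons.injEq] at hy
      obtain ⟨rfl, rfl, rfl⟩ := hy
      subst hx
      have hi1 : j ≠ i := by rintro rfl; exact hj (by simp)
      have hi2 : j' ≠ i := by rintro rfl; exact hj' (by simp)
      rw [Function.update_of_ne hi1, Function.update_of_ne hi2,
        hsol (lo ++ j :: j' :: h1) i y (by simp) w]
      exact LinearMap.congr_fun (Q.K_right p w lo h1 y i j j' hn) (Ψ w)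
  · rcases bs with _ | ⟨b1, l2⟩
    · simp only [List.nil_append, List.cons.injEq, List.append_nil] at hx hy
      obtain ⟨rfl, rfl⟩ := hy
      subst hx
      exact case2
    · simp only [List.cons_append, List.cons.injEq] at hy
      obtain ⟨rfl, rfl⟩ := hy
      subst hx
      have hi1 : j ≠ i := by rintro rfl; exact hj (by simp)
      have hi2 : j' ≠ i := by rintro rfl; exact hj' (by simp)
      rw [Function.update_of_ne hi1, Function.update_of_ne hi2,
        hsol x i (l2 ++ j :: j' :: hi) (by simp) w]
      exact LinearMap.congr_fun (Q.K_left p w x l2 hi i j j' (by simpa using hn)) (Ψ w)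

/-! ### Lists -/

theorem finRange_split {n : ℕ} {x y : List (Fin n)} {i : Fin n}
    (h : List.finRange n = x ++ i :: y) :
    (∀ m, m ∈ x ↔ m < i) ∧ (∀ m, m ∈ y ↔ i < m) := by
  have hp := List.pairwise_lt_finRange n
  rw [h, List.pairwise_append, List.pairwise_cons] at hp
  obtain ⟨-, ⟨hy, -⟩, hx⟩ := hp
  have hm : ∀ m, m ∈ x ∨ m = i ∨ m ∈ y := fun m => by
    have := List.mem_finRange m
    rw [h] at this
    simpa using this
  have hx1 : ∀ m ∈ x, m < i := fun m hm => hx m hm i (by simp)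
  refine ⟨fun m => ⟨hx1 m, fun hlt => ?_⟩, fun m => ⟨hy m, fun hlt => ?_⟩⟩
  · rcases hm m with h | h | h
    · exact h
    · exact absurd hlt (by simp [h])
    · exact absurd (hy m h) (not_lt.2 hlt.le)
  · rcases hm m with h | h | h
    · exact absurd (hx1 m h) (not_lt.2 hlt.le)
    · exact absurd hlt (by simp [h])
    · exact h

theorem finRange_filter {n : ℕ} {x y : List (Fin n)} {i : Fin n}
    (h : List.finRange n = x ++ i :: y) :
    (List.finRange n).filter (fun l => l < i) = x ∧
      (List.finRange n).filter (fun l => i < l) = y := by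
  obtain ⟨hx, hy⟩ := finRange_split h
  rw [h]
  constructor
  · rw [List.filter_append, List.filter_cons_of_neg (by simp),
      List.filter_eq_self.2 (fun m hm => by simpa using (hx m).1 hm),
      List.filter_eq_nil_iff.2 (fun m hm => by simpa using ((hy m).1 hm).le), List.append_nil]
  · rw [List.filter_append, List.filter_cons_of_neg (by simp),
      List.filter_eq_nil_iff.2 (fun m hm => by simpa using ((hx m).1 hm).le),
      List.filter_eq_self.2 (fun m hm => by simpa using (hy m).1 hm), List.nil_append]

theorem finRange_two {n : ℕ} (j j' : Fin n) (h : (j : ℕ) + 1 = (j' : ℕ)) :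
    ∃ lo hi, List.finRange n = lo ++ j :: j' :: hi := by
  obtain ⟨x, y, hxy⟩ := List.append_of_mem (List.mem_finRange j')
  obtain ⟨hx, hy⟩ := finRange_split hxy
  have hj : j ∈ x := (hx j).2 (by rw [Fin.lt_def]; omega)
  obtain ⟨lo, t, hlo⟩ := List.append_of_mem hj
  have h2 : List.finRange n = lo ++ j :: (t ++ j' :: y) := by rw [hxy, hlo]; simp
  obtain ⟨-, h3⟩ := finRange_split h2
  have ht : t = [] := by
    rw [List.eq_nil_iff_forall_not_mem]
    intro m hm
    have h4 : j < m := (h3 m).1 (by simp [hm])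
    have h5 : m < j' := (hx m).1 (by simp [hlo, hm])
    rw [Fin.lt_def] at h4 h5
    omega
  exact ⟨lo, y, by rw [h2, ht]; simp⟩

theorem foldr_comp_snoc {α : Type*} (a : List (α → α)) (h : α → α) (f : α) :
    (a ++ [h]).foldr (· ∘ ·) id f = a.foldr (· ∘ ·) id (h f) := by
  induction a with
  | nil => rfl
  | cons g a ih =>
    simp only [List.cons_append, List.foldr_cons, Function.comp_apply, ih]

/-! ### Transport to the permuted product -/

section Transport

variable {n : ℕ} {B : Fin n → Type*}

theorem permBasis_apply (σ : Equiv.Perm (Fin n)) (b' : ∀ i, B (σ i)) (k : Fin n) :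
    permBasis σ b' (σ k) = b' k := by
  have : ∀ (m : Fin n) (hm : B (σ m) = B (σ k)), m = k → hm ▸ b' m = b' k := by
    intro m hm e; subst e; rfl
  exact this _ _ (σ.symm_apply_apply k)

theorem permBasis_update (σ : Equiv.Perm (Fin n)) (b' : ∀ i, B (σ i)) (k : Fin n)
    (c : B (σ k)) :
    permBasis σ (Function.update b' k c) = Function.update (permBasis σ b') (σ k) c := by
  funext i
  obtain ⟨m, rfl⟩ := σ.surjective i
  rw [permBasis_apply]
  by_cases h : m = k
  · subst h; simp
  · rw [Function.update_of_ne h, Function.update_of_ne (by simpa using h), permBasis_apply]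

/-- Pull back along the permutation of the factors. -/
def pull (σ : Equiv.Perm (Fin n)) (f : ℂ → (∀ i, B i) → ℂ) : ℂ → (∀ i, B (σ i)) → ℂ :=
  fun lam b' => f lam (permBasis σ b')

variable [∀ i, Fintype (B i)] [∀ i, DecidableEq (B i)]

theorem Rop_pull (wt : ∀ i, B i → ℂ) (η : ℂ)
    (R : ∀ k l : Fin n, ℂ → ℂ → (B k × B l) → (B k × B l) → ℂ) (σ : Equiv.Perm (Fin n))
    (k l : Fin n) (S : Finset (Fin n)) (u : ℂ) (f : ℂ → (∀ i, B i) → ℂ)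
    (hS : (Finset.univ.filter (fun i : Fin n => i < l ∧ i ≠ k)).image σ = S) :
    Rop (fun i => B (σ i)) (fun i => wt (σ i)) η (fun k l => R (σ k) (σ l)) k l u (pull σ f) =
      pull σ (Rraw wt η R (σ k) (σ l) S u f) := by
  funext lam b'
  have hw : wsum wt S (permBasis σ b') =
      ∑ i ∈ Finset.univ.filter (fun i : Fin n => i < l ∧ i ≠ k), wt (σ i) (b' i) := by
    rw [← hS, wsum, Finset.sum_image (fun a _ b _ h => σ.injective h)]
    exact Finset.sum_congr rfl fun i _ => by rw [permBasis_apply]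
  simp only [Rop, pull, Rraw_apply, hw, permBasis_apply, permBasis_update]

theorem Gammaop_pull (wt : ∀ i, B i → ℂ) (η : ℂ) (σ : Equiv.Perm (Fin n)) (k : Fin n)
    (f : ℂ → (∀ i, B i) → ℂ) :
    Gammaop (fun i => B (σ i)) (fun i => wt (σ i)) η k (pull σ f) =
      pull σ (Graw wt η (σ k) f) := by
  funext lam b'
  simp only [Gammaop, pull, Graw_apply, permBasis_apply]

variable (wt : ∀ i, B i → ℂ) (η : ℂ)
    (R : ∀ k l : Fin n, ℂ → ℂ → (B k × B l) → (B k × B l) → ℂ)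
    (hzero : ∀ (k l : Fin n) (w lam : ℂ) (b c : B k × B l),
      wt k b.1 + wt l b.2 ≠ wt k c.1 + wt l c.2 → R k l w lam b c = 0)
    (hDYBE : ∀ (k l m' : Fin n) (u v lam : ℂ) (b c : B k × B l × B m'),
      (∑ d : B k × B l × B m', ∑ e : B k × B l × B m',
        T12 B R k l m' u (fun x => lam - 2 * η * wt m' x) b d *
          T13 B R k l m' (u + v) (fun _ => lam) d e *
          T23 B R k l m' v (fun x => lam - 2 * η * wt k x) e c) =
      (∑ d : B k × B l × B m', ∑ e : B k × B l × B m',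
        T23 B R k l m' v (fun _ => lam) b d *
          T13 B R k l m' (u + v) (fun x => lam - 2 * η * wt l x) d e *
          T12 B R k l m' u (fun _ => lam) e c))

theorem fold_pull (σ : Equiv.Perm (Fin n)) (i : Fin n) (v : ℂ) (w u : Fin n → ℂ)
    (hu : ∀ l, u l = v - w (σ l)) (t : List (Fin n)) (hi : i ∉ t) (S : Finset (Fin n))
    (hS : ∀ t1 l t2, t = t1 ++ l :: t2 →
      (Finset.univ.filter (fun m : Fin n => m < l ∧ m ≠ i)).image σ =
        S ∪ (t1.map σ).toFinset) (f : F0 wt) :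
    ((t.reverse.map (fun l => Rop (fun i => B (σ i)) (fun i => wt (σ i)) η
      (fun k l => R (σ k) (σ l)) i l (u l))).foldr (· ∘ ·) id) (pull σ f.1) =
      pull σ ((sys wt η R hzero hDYBE).P (σ i) v w (t.map σ) S f).1 := by
  induction t generalizing S f with
  | nil => rfl
  | cons l t ih =>
    simp only [List.mem_cons, not_or] at hi
    rw [List.reverse_cons, List.map_append, List.map_singleton, foldr_comp_snoc,
      Rop_pull wt η R σ i l S (u l) f.1 (by simpa using hS [] l t rfl),
      ← R0_coe wt η R hzero (σ i) (σ l) S (u l) (by simpa using hi.1) f,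
      ih hi.2 (insert (σ l) S)]
    · simp only [List.map_cons, QSys.P, Module.End.mul_apply, hu]
      rfl
    · intro t1 l' t2 ht
      rw [hS (l :: t1) l' t2 (by rw [ht]; rfl)]
      ext m
      simp only [Finset.mem_union, Finset.mem_insert, List.mem_toFinset, List.map_cons,
        List.mem_cons]
      tauto

theorem Kop_pull (σ : Equiv.Perm (Fin n)) (p : ℂ) (x y : List (Fin n)) (i : Fin n)
    (hxy : List.finRange n = x ++ i :: y) (z w : Fin n → ℂ) (hw : ∀ k, w (σ k) = z k)
    (f : F0 wt) :
    Kop (fun i => B (σ i)) (fun i => wt (σ i)) η p (fun k l => R (σ k) (σ l)) i z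
      (pull σ f.1) =
      pull σ ((sys wt η R hzero hDYBE).K p w (x.map σ) (σ i) (y.map σ) f).1 := by
  obtain ⟨hx, hy⟩ := finRange_filter hxy
  obtain ⟨hx', hy'⟩ := finRange_split hxy
  have hix : i ∉ x := fun h => lt_irrefl _ ((hx' i).1 h)
  have hiy : i ∉ y := fun h => lt_irrefl _ ((hy' i).1 h)
  simp only [Kop, hx, hy, Function.comp_apply]
  rw [fold_pull wt η R hzero hDYBE σ i (w (σ i)) w _ (fun l => by rw [hw, hw]) y hiy
    (x.map σ).toFinset, Gammaop_pull, ← G0_coe,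
    fold_pull wt η R hzero hDYBE σ i (w (σ i) + p) w _ (fun l => by rw [hw, hw]; ring) x hix ∅]
  · rfl
  · intro t1 l t2 ht
    have hs := (finRange_split (x := t1) (i := l) (y := t2 ++ i :: y) (by rw [hxy, ht]; simp)).1
    have hli : l < i := (hx' l).1 (by simp [ht])
    ext m
    simp only [Finset.mem_image, Finset.mem_filter, Finset.mem_univ, true_and,
      Finset.empty_union, List.mem_toFinset, List.mem_map, hs]
    constructor
    · rintro ⟨a, ⟨h1, h2⟩, h3⟩; exact ⟨a, h1, h3⟩
    · rintro ⟨a, h1, h3⟩; exact ⟨a, ⟨h1, (h1.trans hli).ne⟩, h3⟩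
  · intro t1 l t2 ht
    have hs := (finRange_split (x := x ++ i :: t1) (i := l) (y := t2)
      (by rw [hxy, ht]; simp)).1
    have hti : i ∉ t1 := fun h => hiy (by simp [ht, h])
    ext m
    simp only [Finset.mem_image, Finset.mem_filter, Finset.mem_univ, true_and,
      Finset.mem_union, List.mem_toFinset, List.mem_map, ← hs, List.mem_append, List.mem_cons]
    constructor
    · rintro ⟨a, ⟨h1, h2⟩, h3⟩
      rcases h1 with h1 | h1 | h1
      · exact Or.inl ⟨a, h1, h3⟩
      · exact absurd h1 h2
      · exact Or.inr ⟨a, h1, h3⟩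
    · rintro (⟨a, h1, h3⟩ | ⟨a, h1, h3⟩)
      · exact ⟨a, ⟨Or.inl h1, by rintro rfl; exact hix h1⟩, h3⟩
      · exact ⟨a, ⟨Or.inr (Or.inr h1), by rintro rfl; exact hti h1⟩, h3⟩

end Transport

/-- **Monodromy of solutions of the qKZB equations with respect to permutations
of the variables** (Theorem 6.1): if `Ψ(z,λ)` with values in
`(V_{Λ₁}⊗…⊗V_{Λₙ})[0]` solves the qKZB equations with step `p`, whose qKZB
operators are built from zero-weight R-matrices satisfying the dynamical
Yang–Baxter equation, then for a transposition `σ = (j, j+1)` the function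
`Ψ_j(z,λ) = P^{(j,j+1)} R^{(j,j+1)}_{Λ_j,Λ_{j+1}}(z_{j+1}−z_j,
λ−2η∑_{l<j}h^{(l)}) Ψ(…,z_{j+1},z_j,…,λ)` solves the qKZB equations with the
`j`-th and `(j+1)`-th weights and tensor factors interchanged. -/
theorem qKZB_monodromy_permutation {n : ℕ} (B : Fin n → Type*)
    [∀ i, Fintype (B i)] [∀ i, DecidableEq (B i)] (wt : ∀ i, B i → ℂ)
    (Λ : Fin n → ℂ) (τ η p : ℂ)
    (R : ∀ k l : Fin n, ℂ → ℂ → (B k × B l) → (B k × B l) → ℂ)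
    (hzero : ∀ (k l : Fin n) (w lam : ℂ) (b c : B k × B l),
      wt k b.1 + wt l b.2 ≠ wt k c.1 + wt l c.2 → R k l w lam b c = 0)
    (hDYBE : ∀ (k l m' : Fin n) (u v lam : ℂ) (b c : B k × B l × B m'),
      (∑ d : B k × B l × B m', ∑ e : B k × B l × B m',
        T12 B R k l m' u (fun x => lam - 2 * η * wt m' x) b d *
          T13 B R k l m' (u + v) (fun _ => lam) d e *
          T23 B R k l m' v (fun x => lam - 2 * η * wt k x) e c) =
      (∑ d : B k × B l × B m', ∑ e : B k × B l × B m',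
        T23 B R k l m' v (fun _ => lam) b d *
          T13 B R k l m' (u + v) (fun x => lam - 2 * η * wt l x) d e *
          T12 B R k l m' u (fun _ => lam) e c))
    (Ψ : (Fin n → ℂ) → ℂ → (∀ i, B i) → ℂ)
    (hsupp : ∀ (z : Fin n → ℂ) (lam : ℂ) (b : ∀ i, B i),
      (∑ i, wt i (b i)) ≠ 0 → Ψ z lam b = 0)
    (hsol : ∀ (i : Fin n) (z : Fin n → ℂ),
      Ψ (Function.update z i (z i + p)) = Kop B wt η p R i z (Ψ z))
    (j j' : Fin n) (hjj' : (j : ℕ) + 1 = (j' : ℕ)) :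
    ∀ (i : Fin n) (z : Fin n → ℂ),
      (fun (w : Fin n → ℂ) (lam : ℂ) (b' : ∀ i, B (Equiv.swap j j' i)) =>
          ∑ c : B j × B j',
            R j j' (w j' - w j)
              (lam - 2 * η * ∑ l ∈ Finset.univ.filter (fun l : Fin n => l < j),
                wt l (permBasis (Equiv.swap j j') b' l))
              (permBasis (Equiv.swap j j') b' j, permBasis (Equiv.swap j j') b' j') c *
              Ψ (w ∘ Equiv.swap j j') lam
                (Function.update
                  (Function.update (permBasis (Equiv.swap j j') b') j c.1) j' c.2))
        (Function.update z i (z i + p)) =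
      Kop (fun i => B (Equiv.swap j j' i)) (fun i => wt (Equiv.swap j j' i)) η p
        (fun k l => R (Equiv.swap j j' k) (Equiv.swap j j' l)) i z
        ((fun (w : Fin n → ℂ) (lam : ℂ) (b' : ∀ i, B (Equiv.swap j j' i)) =>
          ∑ c : B j × B j',
            R j j' (w j' - w j)
              (lam - 2 * η * ∑ l ∈ Finset.univ.filter (fun l : Fin n => l < j),
                wt l (permBasis (Equiv.swap j j') b' l))
              (permBasis (Equiv.swap j j') b' j, permBasis (Equiv.swap j j') b' j') c *
              Ψ (w ∘ Equiv.swap j j') lam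
                (Function.update
                  (Function.update (permBasis (Equiv.swap j j') b') j c.1) j' c.2)) z) := by
  obtain ⟨lo, hi, hL⟩ := finRange_two j j' hjj'
  have hn : (lo ++ j :: j' :: hi).Nodup := hL ▸ List.nodup_finRange n
  have hall : ∀ i, i ∈ lo ++ j :: j' :: hi := fun i => hL ▸ List.mem_finRange i
  have hlo : Finset.univ.filter (fun l : Fin n => l < j) = lo.toFinset := by
    ext m; simp [(finRange_split hL).1 m]
  have hjne : j ≠ j' := by rintro rfl; omega
  let Ψ0 : (Fin n → ℂ) → F0 wt := fun z => ⟨Ψ z, hsupp z⟩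
  have hsol0 : ∀ x i y, lo ++ j :: j' :: hi = x ++ i :: y → ∀ w : Fin n → ℂ,
      Ψ0 (Function.update w i (w i + p)) =
        (sys wt η R hzero hDYBE).K p w x i y (Ψ0 w) := by
    intro x i y hxy w
    apply Subtype.ext
    have e := Kop_pull wt η R hzero hDYBE (Equiv.refl (Fin n)) p x y i (hL.trans hxy) w w
      (fun _ => rfl) (Ψ0 w)
    have hid : ∀ t : List (Fin n), t.map (Equiv.refl (Fin n)) = t := fun t => List.map_id t
    rw [hid, hid] at e
    exact (hsol i w).trans e
  have hstat : ∀ w : Fin n → ℂ,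
      (fun (lam : ℂ) (b' : ∀ i, B (Equiv.swap j j' i)) =>
          ∑ c : B j × B j',
            R j j' (w j' - w j)
              (lam - 2 * η * ∑ l ∈ Finset.univ.filter (fun l : Fin n => l < j),
                wt l (permBasis (Equiv.swap j j') b' l))
              (permBasis (Equiv.swap j j') b' j, permBasis (Equiv.swap j j') b' j') c *
              Ψ (w ∘ Equiv.swap j j') lam
                (Function.update
                  (Function.update (permBasis (Equiv.swap j j') b') j c.1) j' c.2)) =
        pull (Equiv.swap j j') ((sys wt η R hzero hDYBE).r j j' lo.toFinset
          ((w ∘ Equiv.swap j j') j - (w ∘ Equiv.swap j j') j')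
          (Ψ0 (w ∘ Equiv.swap j j'))).1 := by
    intro w
    have e : ((sys wt η R hzero hDYBE).r j j' lo.toFinset
          ((w ∘ Equiv.swap j j') j - (w ∘ Equiv.swap j j') j')
          (Ψ0 (w ∘ Equiv.swap j j'))).1 = Rraw wt η R j j' lo.toFinset (w j' - w j)
            (Ψ (w ∘ Equiv.swap j j')) := by
      have e1 := R0_coe wt η R hzero j j' lo.toFinset (w j' - w j) hjne
        (Ψ0 (w ∘ Equiv.swap j j'))
      simp only [Function.comp_apply, Equiv.swap_apply_left, Equiv.swap_apply_right]
      exact e1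
    rw [e, hlo]
    rfl
  intro i z
  have hupd : Function.update z i (z i + p) ∘ Equiv.swap j j' =
      Function.update (z ∘ Equiv.swap j j') (Equiv.swap j j' i)
        ((z ∘ Equiv.swap j j') (Equiv.swap j j' i) + p) := by
    funext m
    by_cases hm : m = Equiv.swap j j' i
    · subst hm; simp
    · have : Equiv.swap j j' m ≠ i := fun h => hm (by rw [← h, Equiv.swap_apply_self])
      simp [Function.update_of_ne hm, Function.update_of_ne this]
  obtain ⟨x, y, hxy⟩ := List.append_of_mem (List.mem_finRange i)
  have hmap : lo ++ j' :: j :: hi =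
      x.map (Equiv.swap j j') ++ Equiv.swap j j' i :: y.map (Equiv.swap j j') := by
    have e1 := congrArg (List.map (Equiv.swap j j')) (hL.symm.trans hxy)
    have fix : ∀ t : List (Fin n), (∀ m ∈ t, m ≠ j ∧ m ≠ j') →
        t.map (Equiv.swap j j') = t := by
      intro t ht
      conv_rhs => rw [← List.map_id t]
      exact List.map_congr_left fun m hm =>
        Equiv.swap_apply_of_ne_of_ne (ht m hm).1 (ht m hm).2
    have h1 := finRange_split hL
    have h2 := finRange_split (x := lo ++ [j]) (i := j') (y := hi) (by rw [hL]; simp)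
    have hjlt : j < j' := by rw [Fin.lt_def]; omega
    simp only [List.map_append, List.map_cons, Equiv.swap_apply_left,
      Equiv.swap_apply_right] at e1
    rw [fix lo, fix hi] at e1
    · exact e1
    · intro m hm
      have := (h2.2 m).1 hm
      exact ⟨(hjlt.trans this).ne', this.ne'⟩
    · intro m hm
      have := (h1.1 m).1 hm
      exact ⟨this.ne, (this.trans hjlt).ne⟩
  have key := exchange_all (ev0 wt) ?_ (sys wt η R hzero hDYBE)
    (R0_pt wt η R hzero) (G0_loc wt η) p lo hi j j' hn hall Ψ0 hsol0 _ _ _ hmap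
    (z ∘ Equiv.swap j j')
  · have e := Kop_pull wt η R hzero hDYBE (Equiv.swap j j') p x y i hxy z
      (z ∘ Equiv.swap j j') (fun k => by simp)
      ((sys wt η R hzero hDYBE).r j j' lo.toFinset
          ((z ∘ Equiv.swap j j') j - (z ∘ Equiv.swap j j') j')
          (Ψ0 (z ∘ Equiv.swap j j')))
    rw [← hupd] at key
    rw [← key] at e
    refine (hstat _).trans (e.symm.trans ?_)
    rw [← hstat z]
  · intro f hf
    apply Subtype.ext
    funext lam
    exact hf lam
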